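/- arXiv:1501.02057 — 2 statements merged into one kernel-verified Lean document; each statement's English description precedes it below -/
import Mathlib

section
/- Let S = [0,1] × [0,1] and let g : ℝ × ℝ → ℝ be infinitely differentiable on a neighborhood of S (ContDiff ℝ ⊤ g suffices). Then there exists a constant C ≥ 0 such that for every positive integer N, |(∑_{i=1}^{N-1} ∑_{j=1}^{N-1} g(i/N, j/N)) - N²·∫_S g(x,y) dx dy + (N/2)·(∫_0^1 g(x,0) dx + ∫_0^1 g(x,1) dx + ∫_0^1 g(0,y) dy + ∫_0^1 g(1,y) dy)| ≤ C. -/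
open MeasureTheory Function

/-- Euler–Maclaurin summation on `[0, 1]` to first order, with an explicit remainder bound. -/
theorem abs_sum_Ico_sub_integral_le {f : ℝ → ℝ} (hf : ContDiff ℝ 2 f) {M : ℝ}
    (hM : ∀ x ∈ Set.Icc (0 : ℝ) 1, |iteratedDeriv 2 f x| ≤ M) {N : ℕ} (hN : 0 < N) :
    |∑ i ∈ Finset.Ico 1 N, f ((i : ℝ) / N) - N * (∫ x in (0 : ℝ)..1, f x) + (f 0 + f 1) / 2|
      ≤ M / N := by
  have hM0 : 0 ≤ M := (abs_nonneg _).trans (hM 0 (by simp))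
  have hbound : ∀ x, |iteratedDerivWithin 2 f (Set.uIcc 0 1) x| ≤ M := by
    intro x
    rw [Set.uIcc_of_le zero_le_one]
    by_cases hx : x ∈ Set.Icc (0 : ℝ) 1
    · rw [iteratedDerivWithin_eq_iteratedDeriv (uniqueDiffOn_Icc zero_lt_one) hf.contDiffAt hx]
      exact hM x hx
    · rw [iteratedDerivWithin_succ,
        derivWithin_zero_of_notMem_closure (by rwa [closure_Icc]), abs_zero]
      exact hM0
  have h := trapezoidal_error_le_of_c2 hf.contDiffOn hbound hN
  have hN' : (0 : ℝ) < N := by exact_mod_cast hN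
  have hsum : ∑ k ∈ Finset.range (N - 1), f (0 + ((k : ℝ) + 1) * (1 - 0) / N)
      = ∑ i ∈ Finset.Ico 1 N, f ((i : ℝ) / N) := by
    rw [Finset.sum_Ico_eq_sum_range]
    refine Finset.sum_congr rfl fun k _ => ?_
    push_cast
    ring_nf
  rw [trapezoidal_error, trapezoidal_integral, hsum] at h
  have heq : ∑ i ∈ Finset.Ico 1 N, f ((i : ℝ) / N) - N * (∫ x in (0 : ℝ)..1, f x) + (f 0 + f 1) / 2
      = N * ((1 - 0) / N * ((f 0 + f 1) / 2 + ∑ i ∈ Finset.Ico 1 N, f ((i : ℝ) / N))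
        - ∫ x in (0 : ℝ)..1, f x) := by
    field_simp
    ring
  rw [heq, abs_mul, abs_of_pos hN']
  calc _ ≤ N * (|(1 : ℝ) - 0| ^ 3 * M / (12 * N ^ 2)) := by gcongr
    _ = M / N / 12 := by simp; field_simp
    _ ≤ M / N := div_le_self (by positivity) (by norm_num)

theorem ContDiff.uncurry_deriv {f : ℝ → ℝ → ℝ} {m n : WithTop ℕ∞} (hf : ContDiff ℝ n (uncurry f))
    (hmn : m + 1 ≤ n) : ContDiff ℝ m (uncurry fun x => deriv (f x)) := by
  have hf' : ContDiff ℝ n (uncurry fun (p : ℝ × ℝ) => f p.1) :=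
    hf.comp ((contDiff_fst.comp contDiff_fst).prodMk contDiff_snd)
  have h : ContDiff ℝ m fun p : ℝ × ℝ => fderiv ℝ (f p.1) p.2 :=
    hf'.fderiv contDiff_snd hmn
  exact h.clm_apply contDiff_const

/-- Euler–Maclaurin summation on `[0, 1]`, uniformly in a parameter. -/
theorem exists_abs_sum_Ico_sub_integral_le {f : ℝ → ℝ → ℝ} (hf : ContDiff ℝ 2 (uncurry f)) :
    ∃ M : ℝ, 0 ≤ M ∧ ∀ x ∈ Set.Icc (0 : ℝ) 1, ∀ N : ℕ, 0 < N →
      |∑ i ∈ Finset.Ico 1 N, f x ((i : ℝ) / N) - N * (∫ y in (0 : ℝ)..1, f x y)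
        + (f x 0 + f x 1) / 2| ≤ M / N := by
  have hcont : Continuous (uncurry fun x => deriv (deriv (f x))) :=
    ((hf.uncurry_deriv (m := 1) (by norm_num)).uncurry_deriv (m := 0) (by norm_num)).continuous
  obtain ⟨M, hM⟩ := (isCompact_Icc.prod isCompact_Icc).exists_bound_of_continuousOn
    (s := Set.Icc (0 : ℝ) 1 ×ˢ Set.Icc (0 : ℝ) 1) hcont.continuousOn
  refine ⟨M, (norm_nonneg _).trans (hM (0, 0) (by simp)), fun x hx N hN => ?_⟩
  refine abs_sum_Ico_sub_integral_le (hf.comp (contDiff_prodMk_right x)) (fun y hy => ?_) hN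
  rw [iteratedDeriv_succ, iteratedDeriv_one]
  exact hM (x, y) ⟨hx, hy⟩

/-- Two-dimensional Euler–Maclaurin summation formula on the unit square:
`∑_{i,j=1}^{N-1} g(i/N, j/N) = N² ∫_S g - (N/2) ∫_{∂S} g + O(1)`. -/
theorem euler_maclaurin_two_dim (g : ℝ × ℝ → ℝ) (hg : ContDiff ℝ (⊤ : ℕ∞) g) :
    ∃ C : ℝ, 0 ≤ C ∧ ∀ N : ℕ, 0 < N →
      |(∑ i ∈ Finset.Ico 1 N, ∑ j ∈ Finset.Ico 1 N, g ((i : ℝ) / (N : ℝ), (j : ℝ) / (N : ℝ)))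
          - (N : ℝ) ^ 2 * (∫ p in (Set.Icc (0:ℝ) 1 ×ˢ Set.Icc (0:ℝ) 1), g p)
          + ((N : ℝ) / 2) *
            ((∫ x in (0:ℝ)..1, g (x, 0)) + (∫ x in (0:ℝ)..1, g (x, 1))
              + (∫ y in (0:ℝ)..1, g (0, y)) + (∫ y in (0:ℝ)..1, g (1, y)))| ≤ C := by
  have hg2 : ContDiff ℝ 2 g := contDiff_infty.1 hg 2
  have hc : Continuous g := hg.continuous
  obtain ⟨A, hA0, hA⟩ := exists_abs_sum_Ico_sub_integral_le (f := fun x y => g (x, y)) hg2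
  obtain ⟨B, hB0, hB⟩ := exists_abs_sum_Ico_sub_integral_le (f := fun y x => g (x, y))
    (hg2.comp (contDiff_snd.prodMk contDiff_fst))
  have hcx (x : ℝ) : Continuous fun y => g (x, y) := by fun_prop
  have hcI : Continuous fun y => ∫ x in (0 : ℝ)..1, g (x, y) :=
    intervalIntegral.continuous_parametric_intervalIntegral_of_continuous'
      (f := fun y x => g (x, y)) (by fun_prop) 0 1
  have hdouble : ∫ p in (Set.Icc (0:ℝ) 1 ×ˢ Set.Icc (0:ℝ) 1), g p
      = ∫ y in (0 : ℝ)..1, ∫ x in (0 : ℝ)..1, g (x, y) := by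
    rw [Measure.volume_eq_prod, ← setIntegral_prod_swap, setIntegral_prod]
    · simp [intervalIntegral.integral_of_le, integral_Icc_eq_integral_Ioc]
    · rw [← Measure.volume_eq_prod]
      exact (hc.comp continuous_swap).continuousOn.integrableOn_compact
        (isCompact_Icc.prod isCompact_Icc)
  refine ⟨A + 2 * B + |(g (0, 0) + g (1, 0) + g (0, 1) + g (1, 1)) / 4|, by positivity,
    fun N hN => ?_⟩
  have hN1 : (1 : ℝ) ≤ N := by exact_mod_cast hN
  have hN0 : (0 : ℝ) < N := by linarith
  have hrows : |∑ i ∈ Finset.Ico 1 N, (∑ j ∈ Finset.Ico 1 N, g ((i : ℝ) / N, (j : ℝ) / N)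
      - N * (∫ y in (0 : ℝ)..1, g ((i : ℝ) / N, y))
      + (g ((i : ℝ) / N, 0) + g ((i : ℝ) / N, 1)) / 2)| ≤ A := by
    calc _ ≤ ∑ i ∈ Finset.Ico 1 N, A / N := by
          refine (Finset.abs_sum_le_sum_abs _ _).trans (Finset.sum_le_sum fun i hi => ?_)
          have hi' : (i : ℝ) ≤ N := by exact_mod_cast (Finset.mem_Ico.1 hi).2.le
          exact hA _ ⟨by positivity, (div_le_one hN0).2 hi'⟩ N hN
      _ = (N - 1) * (A / N) := by simp [Nat.cast_sub (Nat.one_le_of_lt hN)]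
      _ ≤ N * (A / N) := by gcongr; linarith
      _ = A := by field_simp
  have hcols : |∑ i ∈ Finset.Ico 1 N, (∫ y in (0 : ℝ)..1, g ((i : ℝ) / N, y))
      - N * (∫ y in (0 : ℝ)..1, ∫ x in (0 : ℝ)..1, g (x, y))
      + ((∫ y in (0 : ℝ)..1, g (0, y)) + ∫ y in (0 : ℝ)..1, g (1, y)) / 2| ≤ B / N := by
    have hint {φ : ℝ → ℝ} (hφ : Continuous φ) : IntervalIntegrable φ volume 0 1 :=
      hφ.intervalIntegrable 0 1
    have heq : ∫ y in (0 : ℝ)..1, (∑ i ∈ Finset.Ico 1 N, g ((i : ℝ) / N, y)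
        - N * (∫ x in (0 : ℝ)..1, g (x, y)) + (g (0, y) + g (1, y)) / 2)
        = ∑ i ∈ Finset.Ico 1 N, (∫ y in (0 : ℝ)..1, g ((i : ℝ) / N, y))
          - N * (∫ y in (0 : ℝ)..1, ∫ x in (0 : ℝ)..1, g (x, y))
          + ((∫ y in (0 : ℝ)..1, g (0, y)) + ∫ y in (0 : ℝ)..1, g (1, y)) / 2 := by
      rw [intervalIntegral.integral_add (hint (by fun_prop)) (hint (by fun_prop)),
        intervalIntegral.integral_sub (hint (by fun_prop)) (hint (by fun_prop)),
        intervalIntegral.integral_finsetSum (fun i _ => hint (hcx _)),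
        intervalIntegral.integral_const_mul, intervalIntegral.integral_div,
        intervalIntegral.integral_add (hint (hcx 0)) (hint (hcx 1))]
    rw [← heq, ← Real.norm_eq_abs]
    refine (intervalIntegral.norm_integral_le_of_norm_le_const fun y hy => ?_).trans_eq
      (by simp : B / N * |(1 : ℝ) - 0| = B / N)
    rw [Set.uIoc_of_le zero_le_one] at hy
    exact hB y ⟨hy.1.le, hy.2⟩ N hN
  have hcols' := mul_le_mul_of_nonneg_left hcols hN0.le
  rw [mul_div_cancel₀ _ hN0.ne', ← abs_of_pos hN0, ← abs_mul, abs_of_pos hN0] at hcols'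
  have hBN : B / N ≤ B := div_le_self hB0 hN1
  have hbot := (hB 0 (by simp) N hN).trans hBN
  have htop := (hB 1 (by simp) N hN).trans hBN
  have hcorner := le_refl |(g (0, 0) + g (1, 0) + g (0, 1) + g (1, 1)) / 4|
  rw [hdouble]
  simp only [Finset.sum_add_distrib, Finset.sum_sub_distrib, ← Finset.mul_sum,
    ← Finset.sum_div] at hrows
  rw [abs_le] at *
  constructor <;> linarith
end

section
/- For all real numbers a > 0 and b > 0 there exist a function L : ℤ × ℤ → ℝ and a constant C ≥ 0 such that: (i) L(0,0) = 0; (ii) L is even in each coordinate, i.e. L(-x,y) = L(x,y) = L(x,-y) for all (x,y); (iii) for all (x,y) ∈ ℤ², (1/a)·(L(x+1,y) - 2 L(x,y) + L(x-1,y)) + (1/b)·(L(x,y+1) - 2 L(x,y) + L(x,y-1)) = (1 if (x,y) = (0,0), else 0); (iv) L(1,0) = (a/π)·arctan(√(b/a)) and L(0,1) = (b/π)·arctan(√(a/b)); (v) for all (x,y) ≠ (0,0), |L(x,y) - (√(a·b)/(4π))·log((16·exp(2γ)/(a+b))·(a x² + b y²))| ≤ C/(x² + y²), where γ is the Euler–Mascheroni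 constant; and (vi) for all (x,y) ≠ (0,0), |(L(x+1,y) - L(x-1,y))/2 - (√(a·b)/(2π))·(a x)/(a x² + b y²)| ≤ C/(x² + y²)^{3/2}. -/
namespace LatticeLog

open Real Set Filter Topology MeasureTheory

/-- The decay rate `α(θ) ≥ 0` determined by `cosh α = 1 + k² (1 - cos θ)`. -/
noncomputable def rate (k θ : ℝ) : ℝ := 2 * arsinh (k * sin (θ / 2))

lemma continuous_rate (k : ℝ) : Continuous (rate k) :=
  continuous_const.mul (continuous_const.mul (continuous_sin.comp (continuous_id.div_const 2))).arsinh

lemma sinh_rate (k θ : ℝ) :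
    sinh (rate k θ) = 2 * (k * sin (θ / 2)) * √(1 + (k * sin (θ / 2)) ^ 2) := by
  rw [rate, sinh_two_mul, sinh_arsinh, cosh_arsinh]

lemma cosh_rate (k θ : ℝ) : cosh (rate k θ) = 1 + k ^ 2 * (1 - cos θ) := by
  have h : cos θ = 1 - 2 * sin (θ / 2) ^ 2 := by
    have h1 := cos_two_mul (θ / 2)
    have h2 := sin_sq_add_cos_sq (θ / 2)
    rw [mul_div_cancel₀ θ two_ne_zero] at h1
    linarith
  rw [rate, cosh_two_mul, sinh_arsinh, cosh_arsinh, sq_sqrt (by positivity), h]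
  ring

lemma arsinh_le_self {v : ℝ} (hv : 0 ≤ v) : arsinh v ≤ v := by
  have := self_le_sinh_iff.2 (arsinh_nonneg_iff.2 hv)
  rwa [sinh_arsinh] at this

lemma div_sqrt_le_arsinh {v : ℝ} (hv : 0 ≤ v) : v / √(1 + v ^ 2) ≤ arsinh v := by
  have hm : MonotoneOn (fun t => t * cosh t - sinh t) (Ici 0) := by
    refine monotoneOn_of_deriv_nonneg (convex_Ici 0) (by fun_prop) (by fun_prop) ?_
    intro t ht
    rw [interior_Ici] at ht
    have hd : HasDerivAt (fun t => t * cosh t - sinh t) (1 * cosh t + t * sinh t - cosh t) t :=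
      ((hasDerivAt_id t).mul (hasDerivAt_cosh t)).sub (hasDerivAt_sinh t)
    rw [hd.deriv]
    have := mul_nonneg (le_of_lt ht) (sinh_nonneg_iff.2 (le_of_lt ht))
    linarith
  have h0 := arsinh_nonneg_iff.2 hv
  have h := hm (mem_Ici.2 le_rfl) (mem_Ici.2 h0) h0
  simp only [zero_mul, sinh_zero, sub_zero, sinh_arsinh, cosh_arsinh] at h
  rw [div_le_iff₀ (by positivity)]
  linarith

lemma sqrt_one_add_sq_le (v : ℝ) : √(1 + v ^ 2) ≤ 1 + v ^ 2 / 2 := by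
  rw [sqrt_le_left (by positivity)]
  nlinarith [sq_nonneg (v ^ 2)]

lemma one_le_sqrt_one_add_sq (v : ℝ) : 1 ≤ √(1 + v ^ 2) := by
  rw [one_le_sqrt]; nlinarith [sq_nonneg v]

lemma sub_arsinh_le {v : ℝ} (hv : 0 ≤ v) : v - arsinh v ≤ v ^ 3 := by
  have h1 := div_sqrt_le_arsinh hv
  have h2 := sqrt_one_add_sq_le v
  have h3 := one_le_sqrt_one_add_sq v
  have h4 : v * (1 - v ^ 2) ≤ v / √(1 + v ^ 2) := by
    rw [le_div_iff₀ (by positivity)]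
    rw [mul_assoc]
    refine mul_le_of_le_one_right hv ?_
    nlinarith [sq_nonneg v, sq_nonneg (v ^ 2)]
  nlinarith

section Bounds

variable {k θ : ℝ}

lemma sin_half_lower (h0 : 0 ≤ θ) (h1 : θ ≤ π) : θ / π ≤ sin (θ / 2) := by
  have := mul_le_sin (x := θ / 2) (by linarith) (by linarith)
  calc θ / π = 2 / π * (θ / 2) := by ring
    _ ≤ _ := this

lemma sin_half_upper (h0 : 0 ≤ θ) : sin (θ / 2) ≤ θ / 2 := sin_le (by linarith)

lemma sin_half_cube (h0 : 0 ≤ θ) : θ - 2 * sin (θ / 2) ≤ θ ^ 3 := by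
  have := sin_ge_sub_cube (x := θ / 2) (by linarith)
  have := pow_nonneg h0 3
  nlinarith

lemma sin_half_pos (h0 : 0 < θ) (h1 : θ ≤ π) : 0 < sin (θ / 2) :=
  sin_pos_of_pos_of_lt_pi (by linarith) (by linarith [pi_pos])

lemma rate_pos (hk : 0 < k) (h0 : 0 < θ) (h1 : θ ≤ π) : 0 < rate k θ := by
  have := arsinh_pos_iff.2 (mul_pos hk (sin_half_pos h0 h1))
  unfold rate; linarith

/-- A constant for which `rate k θ ≥ rateConst k * θ` on `[0, π]`. -/
noncomputable def rateConst (k : ℝ) : ℝ := 2 * k / (π * √(1 + k ^ 2))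

lemma rateConst_pos (hk : 0 < k) : 0 < rateConst k := by
  unfold rateConst; positivity

lemma rateConst_le (hk : 0 < k) : rateConst k ≤ k := by
  unfold rateConst
  rw [div_le_iff₀ (by positivity), mul_comm 2 k]
  have h3 := one_le_sqrt_one_add_sq k
  refine mul_le_mul_of_nonneg_left ?_ hk.le
  nlinarith [pi_gt_three]

lemma rate_lower (hk : 0 < k) (h0 : 0 ≤ θ) (h1 : θ ≤ π) : rateConst k * θ ≤ rate k θ := by
  have hs := sin_half_lower h0 h1
  have hs0 : 0 ≤ θ / π := by positivity
  have hv : 0 ≤ k * sin (θ / 2) := mul_nonneg hk.le (hs0.trans hs)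
  have h := div_sqrt_le_arsinh hv
  have hle : √(1 + (k * sin (θ / 2)) ^ 2) ≤ √(1 + k ^ 2) := by
    apply sqrt_le_sqrt
    have := sin_sq_le_one (θ / 2)
    have := mul_le_mul_of_nonneg_left this (sq_nonneg k)
    rw [mul_pow]; linarith
  have : k * (θ / π) / √(1 + k ^ 2) ≤ k * sin (θ / 2) / √(1 + (k * sin (θ / 2)) ^ 2) := by
    gcongr
  unfold rate rateConst
  calc 2 * k / (π * √(1 + k ^ 2)) * θ = 2 * (k * (θ / π) / √(1 + k ^ 2)) := by
        field_simp
    _ ≤ _ := by linarith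

lemma abs_rate_sub_le (hk : 0 < k) (h0 : 0 ≤ θ) (h1 : θ ≤ π) :
    |rate k θ - k * θ| ≤ (k + k ^ 3) * θ ^ 3 := by
  have hs := sin_half_upper h0
  have hs' := sin_half_cube h0
  have hs0 : 0 ≤ sin (θ / 2) := le_trans (by positivity) (sin_half_lower h0 h1)
  have hv : 0 ≤ k * sin (θ / 2) := mul_nonneg hk.le hs0
  have h := arsinh_le_self hv
  have h' := sub_arsinh_le hv
  have h3 : (k * sin (θ / 2)) ^ 3 ≤ (k * (θ / 2)) ^ 3 := by gcongr
  have h4 : k * (θ - 2 * sin (θ / 2)) ≤ k * θ ^ 3 := by gcongr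
  have h5 : k * sin (θ / 2) ≤ k * (θ / 2) := by gcongr
  have h6 : 0 ≤ k ^ 3 * θ ^ 3 := by positivity
  have h7 : 0 ≤ k * θ ^ 3 := by positivity
  unfold rate
  rw [abs_le]
  constructor <;> nlinarith

lemma sinh_rate_lower (hk : 0 < k) (h0 : 0 ≤ θ) (h1 : θ ≤ π) :
    2 * k / π * θ ≤ sinh (rate k θ) := by
  rw [sinh_rate]
  have h3 := one_le_sqrt_one_add_sq (k * sin (θ / 2))
  have hs := sin_half_lower h0 h1
  have hs0 : 0 ≤ θ / π := by positivity
  have hs1 : 0 ≤ sin (θ / 2) := hs0.trans hs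
  calc 2 * k / π * θ = 2 * (k * (θ / π)) * 1 := by ring
    _ ≤ _ := by gcongr

lemma abs_inv_sinh_rate_sub_le (hk : 0 < k) (h0 : 0 < θ) (h1 : θ ≤ π) :
    |1 / sinh (rate k θ) - 1 / (k * θ)| ≤ (k + 2 / k) * θ := by
  have hs0 := sin_half_pos h0 h1
  have hs := sin_half_upper h0.le
  have hs' := sin_half_cube h0.le
  have hl := sin_half_lower h0.le h1
  rw [sinh_rate]
  set s := sin (θ / 2)
  set q := √(1 + (k * s) ^ 2) with hq
  have q1 : 1 ≤ q := one_le_sqrt_one_add_sq (k * s)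
  have q2 : q ≤ 1 + (k * s) ^ 2 / 2 := sqrt_one_add_sq_le (k * s)
  have e1 : 1 / (2 * (k * s) * q) - 1 / (k * θ)
      = (θ - 2 * s) / (2 * k * s * θ) - (q - 1) / (2 * (k * s) * q) := by
    field_simp
    ring
  have b1 : (θ - 2 * s) / (2 * k * s * θ) ≤ 2 / k * θ := by
    rw [div_le_iff₀ (by positivity)]
    have : θ ≤ 4 * s := by
      have : θ ≤ s * π := by rwa [div_le_iff₀ pi_pos] at hl
      nlinarith [pi_lt_four]
    calc θ - 2 * s ≤ θ ^ 3 := hs'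
      _ = θ * θ * θ := by ring
      _ ≤ θ * θ * (4 * s) := by gcongr
      _ = 2 / k * θ * (2 * k * s * θ) := by field_simp; ring
  have b1' : 0 ≤ (θ - 2 * s) / (2 * k * s * θ) := div_nonneg (by linarith) (by positivity)
  have b2 : (q - 1) / (2 * (k * s) * q) ≤ k * θ := by
    rw [div_le_iff₀ (by positivity)]
    calc q - 1 ≤ (k * s) * (k * s) := by nlinarith
      _ ≤ (k * θ) * (2 * (k * s) * 1) := by
        have : k * s ≤ k * θ := by gcongr; linarith
        have : (k * s) * (k * s) ≤ (k * θ) * (k * s) := by gcongr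
        nlinarith [mul_pos hk hs0]
      _ ≤ k * θ * (2 * (k * s) * q) := by gcongr
  have b2' : 0 ≤ (q - 1) / (2 * (k * s) * q) := div_nonneg (by linarith) (by positivity)
  rw [e1, abs_le]
  have : 0 < k * θ := by positivity
  have : 0 < 2 / k * θ := by positivity
  constructor <;> linarith

lemma abs_exp_neg_sub_exp_neg_le {u v m : ℝ} (hu : m ≤ u) (hv : m ≤ v) :
    |exp (-u) - exp (-v)| ≤ |u - v| * exp (-m) := by
  wlog h : u ≤ v generalizing u v
  · rw [abs_sub_comm, abs_sub_comm u]
    exact this hv hu (le_of_not_ge h)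
  have h1 : exp (-v) ≤ exp (-u) := exp_le_exp.2 (by linarith)
  rw [abs_of_nonneg (by linarith), abs_of_nonpos (by linarith)]
  have h2 : exp (-v) = exp (-u) * exp (-(v - u)) := by rw [← exp_add]; congr 1; ring
  have h3 := one_sub_le_exp_neg (v - u)
  have h4 : exp (-u) ≤ exp (-m) := exp_le_exp.2 (by linarith)
  calc exp (-u) - exp (-v) = exp (-u) * (1 - exp (-(v - u))) := by rw [h2]; ring
    _ ≤ exp (-u) * (v - u) := mul_le_mul_of_nonneg_left (by linarith) (exp_pos _).le
    _ ≤ exp (-m) * (v - u) := mul_le_mul_of_nonneg_right h4 (by linarith)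
    _ = _ := by ring

lemma abs_exp_rate_sub_le (hk : 0 < k) (h0 : 0 ≤ θ) (h1 : θ ≤ π) {y : ℝ} (hy : 0 ≤ y) :
    |exp (-(y * rate k θ)) - exp (-(y * (k * θ)))|
      ≤ (k + k ^ 3) * (y * θ ^ 3) * exp (-(rateConst k * (y * θ))) := by
  have h2 : rateConst k * (y * θ) ≤ y * rate k θ := by
    have := mul_le_mul_of_nonneg_left (rate_lower hk h0 h1) hy
    linarith
  have h3 : rateConst k * (y * θ) ≤ y * (k * θ) := by
    have := mul_le_mul_of_nonneg_right (rateConst_le hk) (mul_nonneg hy h0)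
    linarith
  refine (abs_exp_neg_sub_exp_neg_le h2 h3).trans ?_
  gcongr
  rw [← mul_sub, abs_mul, abs_of_nonneg hy]
  calc y * |rate k θ - k * θ| ≤ y * ((k + k ^ 3) * θ ^ 3) := by
        gcongr; exact abs_rate_sub_le hk h0 h1
    _ = _ := by ring

lemma exp_rate_le (hk : 0 < k) (h0 : 0 ≤ θ) (h1 : θ ≤ π) {y : ℝ} (hy : 0 ≤ y) :
    exp (-(y * rate k θ)) ≤ exp (-(rateConst k * (y * θ))) := by
  apply exp_le_exp.2
  have := mul_le_mul_of_nonneg_left (rate_lower hk h0 h1) hy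
  linarith

end Bounds

section IntegralTools

lemma intervalIntegrable_of_bounded {f : ℝ → ℝ} (hf : Measurable f) {a b M : ℝ} (hab : a ≤ b)
    (h : ∀ t ∈ Ioc a b, |f t| ≤ M) : IntervalIntegrable f volume a b := by
  refine (intervalIntegrable_const (c := M)).mono_fun' hf.aestronglyMeasurable ?_
  rw [uIoc_of_le hab]
  exact (ae_restrict_iff' measurableSet_Ioc).2 (Eventually.of_forall h)

lemma integral_cos_mul_exp {Y : ℝ} (hY : 0 < Y) (x : ℝ) :
    ∫ θ in 0..π, cos (x * θ) * exp (-(Y * θ))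
      = (Y + exp (-(Y * π)) * (x * sin (x * π) - Y * cos (x * π))) / (x ^ 2 + Y ^ 2) := by
  have hp : x ^ 2 + Y ^ 2 ≠ 0 := by positivity
  have hd : ∀ θ ∈ uIcc 0 π, HasDerivAt
      (fun θ => exp (-(Y * θ)) * (x * sin (x * θ) - Y * cos (x * θ)) / (x ^ 2 + Y ^ 2))
      (cos (x * θ) * exp (-(Y * θ))) θ := by
    intro θ _
    have h1 : HasDerivAt (fun θ => x * θ) x θ := by simpa using (hasDerivAt_id θ).const_mul x
    have h2 : HasDerivAt (fun θ => -(Y * θ)) (-Y) θ := by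
      simpa using ((hasDerivAt_id θ).const_mul Y).fun_neg
    have h3 := (h2.exp.fun_mul ((h1.sin.const_mul x).fun_sub (h1.cos.const_mul Y))).div_const
      (x ^ 2 + Y ^ 2)
    refine h3.congr_deriv ?_
    field_simp
    ring
  rw [intervalIntegral.integral_eq_sub_of_hasDerivAt hd
    (Continuous.intervalIntegrable (by fun_prop) _ _)]
  simp only [mul_zero, neg_zero, exp_zero, sin_zero, cos_zero]
  ring

lemma integral_sin_mul_exp {Y : ℝ} (hY : 0 < Y) (x : ℝ) :
    ∫ θ in 0..π, sin (x * θ) * exp (-(Y * θ))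
      = (x - exp (-(Y * π)) * (x * cos (x * π) + Y * sin (x * π))) / (x ^ 2 + Y ^ 2) := by
  have hp : x ^ 2 + Y ^ 2 ≠ 0 := by positivity
  have hd : ∀ θ ∈ uIcc 0 π, HasDerivAt
      (fun θ => -(exp (-(Y * θ)) * (x * cos (x * θ) + Y * sin (x * θ)) / (x ^ 2 + Y ^ 2)))
      (sin (x * θ) * exp (-(Y * θ))) θ := by
    intro θ _
    have h1 : HasDerivAt (fun θ => x * θ) x θ := by simpa using (hasDerivAt_id θ).const_mul x
    have h2 : HasDerivAt (fun θ => -(Y * θ)) (-Y) θ := by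
      simpa using ((hasDerivAt_id θ).const_mul Y).fun_neg
    have h3 := ((h2.exp.fun_mul ((h1.cos.const_mul x).fun_add (h1.sin.const_mul Y))).div_const
      (x ^ 2 + Y ^ 2)).fun_neg
    refine h3.congr_deriv ?_
    field_simp
    ring
  rw [intervalIntegral.integral_eq_sub_of_hasDerivAt hd
    (Continuous.intervalIntegrable (by fun_prop) _ _)]
  simp only [mul_zero, neg_zero, exp_zero, sin_zero, cos_zero]
  ring

lemma abs_add_div_sq_add_sq_le {Y : ℝ} (hY : 0 < Y) (x : ℝ) :
    (|x| + Y) / (x ^ 2 + Y ^ 2) ≤ 2 / Y := by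
  rw [div_le_div_iff₀ (by positivity) hY, ← sq_abs x]
  nlinarith [sq_nonneg (|x| - Y), sq_nonneg |x|]

lemma abs_integral_cos_mul_exp_sub_le {Y : ℝ} (hY : 0 < Y) (x : ℝ) :
    |(∫ θ in 0..π, cos (x * θ) * exp (-(Y * θ))) - Y / (x ^ 2 + Y ^ 2)|
      ≤ exp (-(Y * π)) * (2 / Y) := by
  rw [integral_cos_mul_exp hY, ← sub_div, add_sub_cancel_left, mul_div_assoc, abs_mul,
    abs_of_pos (exp_pos _), abs_div, abs_of_pos (by positivity : 0 < x ^ 2 + Y ^ 2)]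
  refine mul_le_mul_of_nonneg_left ?_ (exp_pos _).le
  refine le_trans ?_ (abs_add_div_sq_add_sq_le hY x)
  gcongr
  refine (abs_sub _ _).trans ?_
  rw [abs_mul, abs_mul, abs_of_pos hY]
  have := mul_le_mul_of_nonneg_left (abs_sin_le_one (x * π)) (abs_nonneg x)
  have := mul_le_mul_of_nonneg_left (abs_cos_le_one (x * π)) hY.le
  linarith

lemma abs_integral_sin_mul_exp_sub_le {Y : ℝ} (hY : 0 < Y) (x : ℝ) :
    |(∫ θ in 0..π, sin (x * θ) * exp (-(Y * θ))) - x / (x ^ 2 + Y ^ 2)|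
      ≤ exp (-(Y * π)) * (2 / Y) := by
  rw [integral_sin_mul_exp hY, ← sub_div, sub_sub_cancel_left, neg_div, abs_neg, mul_div_assoc,
    abs_mul, abs_of_pos (exp_pos _), abs_div, abs_of_pos (by positivity : 0 < x ^ 2 + Y ^ 2)]
  refine mul_le_mul_of_nonneg_left ?_ (exp_pos _).le
  refine le_trans ?_ (abs_add_div_sq_add_sq_le hY x)
  gcongr
  refine (abs_add_le _ _).trans ?_
  rw [abs_mul, abs_mul, abs_of_pos hY]
  have := mul_le_mul_of_nonneg_left (abs_cos_le_one (x * π)) (abs_nonneg x)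
  have := mul_le_mul_of_nonneg_left (abs_sin_le_one (x * π)) hY.le
  linarith

lemma pow_mul_exp_neg_le (m : ℕ) {c u : ℝ} (hc : 0 < c) (hu : 0 ≤ u) :
    u ^ m * exp (-(c * u)) ≤ m.factorial / c ^ m := by
  have h := pow_div_factorial_le_exp (x := c * u) (by positivity) m
  have hm : (0 : ℝ) < m.factorial := by positivity
  rw [div_le_iff₀ hm, mul_pow] at h
  rw [exp_neg, ← div_eq_mul_inv, div_le_div_iff₀ (exp_pos _) (by positivity)]
  linarith

lemma abs_integral_le_of_decay (n : ℕ) {c : ℝ} (hc : 0 < c) :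
    ∃ K : ℝ, 0 ≤ K ∧ ∀ (y M : ℝ) (f : ℝ → ℝ), 0 < y → 0 ≤ M →
      (∀ θ ∈ Ioc 0 π, |f θ| ≤ M * (θ ^ n * (1 + y * θ) * exp (-(c * (y * θ))))) →
      |∫ θ in 0..π, f θ| ≤ M * K / y ^ (n + 1) := by
  set K₀ : ℝ := n.factorial / (c / 2) ^ n + (n + 1).factorial / (c / 2) ^ (n + 1) with hK₀
  have hK₀0 : 0 ≤ K₀ := by positivity
  refine ⟨K₀ * (2 * (2 / c)), by positivity, fun y M f hy hM hf => ?_⟩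
  have key : ∀ θ ∈ Ioc 0 π,
      |f θ| ≤ M * (K₀ / y ^ n) * (cos (0 * θ) * exp (-((c / 2 * y) * θ))) := by
    intro θ hθ
    refine (hf θ hθ).trans ?_
    rw [mul_assoc M]
    refine mul_le_mul_of_nonneg_left ?_ hM
    have hu : 0 ≤ y * θ := mul_nonneg hy.le hθ.1.le
    have h1 := pow_mul_exp_neg_le n (half_pos hc) hu
    have h2 := pow_mul_exp_neg_le (n + 1) (half_pos hc) hu
    have e : exp (-(c * (y * θ))) = exp (-(c / 2 * (y * θ))) * exp (-((c / 2 * y) * θ)) := by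
      rw [← exp_add]; congr 1; ring
    rw [zero_mul, cos_zero, one_mul, e, div_mul_eq_mul_div K₀, le_div_iff₀ (by positivity)]
    calc θ ^ n * (1 + y * θ) * (exp (-(c / 2 * (y * θ))) * exp (-((c / 2 * y) * θ))) * y ^ n
        = ((y * θ) ^ n * exp (-(c / 2 * (y * θ))) + (y * θ) ^ (n + 1) * exp (-(c / 2 * (y * θ))))
          * exp (-((c / 2 * y) * θ)) := by ring
      _ ≤ K₀ * exp (-((c / 2 * y) * θ)) := by
          gcongr
          rw [hK₀]
          exact add_le_add h1 h2
  have hY : 0 < c / 2 * y := by positivity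
  have hb := intervalIntegral.norm_integral_le_of_norm_le (f := f) (μ := volume) pi_pos.le
    (Eventually.of_forall key) (Continuous.intervalIntegrable (by fun_prop) _ _)
  rw [norm_eq_abs, intervalIntegral.integral_const_mul] at hb
  refine hb.trans ?_
  have h5 : (∫ θ in 0..π, cos (0 * θ) * exp (-((c / 2 * y) * θ))) ≤ 2 * (2 / (c * y)) * 1 := by
    rw [integral_cos_mul_exp hY]
    simp only [zero_mul, cos_zero, zero_sub, mul_one, ne_eq, OfNat.ofNat_ne_zero,
      not_false_eq_true, zero_pow, zero_add, mul_neg]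
    rw [div_le_iff₀ (by positivity)]
    have := mul_pos (exp_pos (-(c / 2 * y * π))) hY
    have e : 2 * (2 / (c * y)) * (c / 2 * y) ^ 2 = 2 * (c / 2 * y) := by field_simp
    rw [e]
    linarith
  calc M * (K₀ / y ^ n) * (∫ θ in 0..π, cos (0 * θ) * exp (-((c / 2 * y) * θ)))
      ≤ M * (K₀ / y ^ n) * (2 * (2 / (c * y)) * 1) := by gcongr
    _ = M * (K₀ * (2 * (2 / c))) / y ^ (n + 1) := by rw [pow_succ y]; field_simp

end IntegralTools

section Ein

lemma integral_congr_Ioc {f g : ℝ → ℝ} {a b : ℝ} (hab : a ≤ b) (h : ∀ t ∈ Ioc a b, f t = g t) :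
    ∫ t in a..b, f t = ∫ t in a..b, g t := by
  rw [intervalIntegral.integral_of_le hab, intervalIntegral.integral_of_le hab]
  exact setIntegral_congr_fun measurableSet_Ioc h

lemma measurable_ein : Measurable fun t : ℝ => (1 - exp (-t)) / t := by fun_prop

lemma abs_ein_integrand_le {t : ℝ} (ht : 0 < t) : |(1 - exp (-t)) / t| ≤ 1 := by
  have h1 := one_sub_le_exp_neg t
  have h2 : exp (-t) ≤ 1 := exp_le_one_iff.2 (by linarith)
  rw [abs_of_nonneg (div_nonneg (by linarith) ht.le), div_le_one ht]
  linarith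

lemma intervalIntegrable_ein {a b : ℝ} (ha : 0 ≤ a) (hab : a ≤ b) :
    IntervalIntegrable (fun t : ℝ => (1 - exp (-t)) / t) volume a b :=
  intervalIntegrable_of_bounded measurable_ein hab
    fun _ ht => abs_ein_integrand_le (ha.trans_lt ht.1)

lemma integral_ein_scale {Y p : ℝ} (hY : 0 < Y) :
    ∫ θ in 0..p, (1 - exp (-(Y * θ))) / θ = ∫ t in 0..(Y * p), (1 - exp (-t)) / t := by
  have h := intervalIntegral.integral_comp_mul_left (a := 0) (b := p)
    (fun t : ℝ => (1 - exp (-t)) / t) hY.ne'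
  rw [mul_zero, smul_eq_mul] at h
  rw [← mul_inv_cancel_left₀ hY.ne' (∫ t in 0..(Y * p), (1 - exp (-t)) / t), ← h,
    ← intervalIntegral.integral_const_mul]
  congr 1
  ext θ
  field_simp

lemma harmonic_eq_integral (n : ℕ) :
    (harmonic n : ℝ) = ∫ s in (0 : ℝ)..1, (1 - (1 - s) ^ n) / s := by
  have h1 : ∫ s in (0 : ℝ)..1, (1 - (1 - s) ^ n) / s
      = ∫ s in (0 : ℝ)..1, ∑ i ∈ Finset.range n, (1 - s) ^ i := by
    refine integral_congr_Ioc zero_le_one fun s hs => ?_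
    have h := geom_sum_mul_neg (1 - s) n
    rw [sub_sub_cancel] at h
    rw [← h, mul_div_cancel_right₀ _ hs.1.ne']
  rw [h1, intervalIntegral.integral_finsetSum
    (fun i _ => Continuous.intervalIntegrable (by fun_prop) _ _), harmonic]
  push_cast
  refine Finset.sum_congr rfl fun i _ => ?_
  rw [intervalIntegral.integral_comp_sub_left (fun s : ℝ => s ^ i) 1]
  simp [integral_pow]

lemma abs_exp_sub_one_sub_pow_le (n : ℕ) {s : ℝ} (h0 : 0 ≤ s) (h1 : s ≤ 1) :
    |exp (-(n * s)) - (1 - s) ^ n| ≤ n * s ^ 2 * exp (-(n * s)) := by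
  have e : exp (-(n * s)) = exp (-s) ^ n := by rw [← exp_nat_mul]; congr 1; ring
  have hle : (1 - s) ^ n ≤ exp (-(n * s)) := by
    rw [e]; exact pow_le_pow_left₀ (by linarith) (one_sub_le_exp_neg s) n
  rw [abs_of_nonneg (by linarith)]
  have h2 : 1 - s ^ 2 ≤ (1 - s) * exp s := by
    have := mul_le_mul_of_nonneg_left (add_one_le_exp s) (by linarith : 0 ≤ 1 - s)
    nlinarith
  have h3 : 1 - n * s ^ 2 ≤ ((1 - s) * exp s) ^ n := by
    refine le_trans ?_ (pow_le_pow_left₀ (by nlinarith) h2 n)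
    have := one_add_mul_le_pow (a := -s ^ 2) (by nlinarith) n
    rw [sub_eq_add_neg 1 (s ^ 2)]
    linarith
  have h4 : (1 - s) ^ n = ((1 - s) * exp s) ^ n * exp (-(n * s)) := by
    rw [e, ← mul_pow, mul_assoc, ← exp_add, add_neg_cancel, exp_zero, mul_one]
  have h5 := mul_le_mul_of_nonneg_right h3 (exp_pos (-(n * s))).le
  rw [← h4] at h5
  linarith

lemma abs_harmonic_sub_ein_le {n : ℕ} (hn : 0 < n) :
    |(harmonic n : ℝ) - ∫ t in 0..(n : ℝ), (1 - exp (-t)) / t| ≤ 1 / n := by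
  have hn' : (0 : ℝ) < n := Nat.cast_pos.2 hn
  have hs := integral_ein_scale (p := 1) hn'
  rw [mul_one] at hs
  have i1 : IntervalIntegrable (fun s : ℝ => (1 - (1 - s) ^ n) / s) volume 0 1 := by
    refine intervalIntegrable_of_bounded (M := n) (by fun_prop) zero_le_one fun s hs => ?_
    have h := one_add_mul_le_pow (a := -s) (by linarith [hs.2]) n
    have h' : (1 - s) ^ n ≤ 1 := pow_le_one₀ (by linarith [hs.2]) (by linarith [hs.1])
    rw [← sub_eq_add_neg] at h
    rw [abs_of_nonneg (div_nonneg (by linarith) hs.1.le), div_le_iff₀ hs.1]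
    linarith
  have i2 : IntervalIntegrable (fun s : ℝ => (1 - exp (-(n * s))) / s) volume 0 1 := by
    refine intervalIntegrable_of_bounded (M := n) (by fun_prop) zero_le_one fun s hs => ?_
    have h := abs_ein_integrand_le (mul_pos hn' hs.1)
    have e : (1 - exp (-(n * s))) / s = n * ((1 - exp (-(n * s))) / (n * s)) := by
      have := hs.1.ne'
      field_simp
    rw [e, abs_mul, abs_of_pos hn']
    exact mul_le_of_le_one_right hn'.le h
  rw [harmonic_eq_integral, ← hs, ← intervalIntegral.integral_sub i1 i2]
  have key : ∀ s ∈ Ioc (0 : ℝ) 1, ‖(1 - (1 - s) ^ n) / s - (1 - exp (-(n * s))) / s‖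
      ≤ n * s * exp (-(n * s)) := by
    intro s hs
    rw [← sub_div, sub_sub_sub_cancel_left, norm_eq_abs, abs_div, abs_of_pos hs.1,
      div_le_iff₀ hs.1]
    refine (abs_exp_sub_one_sub_pow_le n hs.1.le hs.2).trans (le_of_eq ?_)
    ring
  have hb := intervalIntegral.norm_integral_le_of_norm_le (μ := volume) zero_le_one
    (Eventually.of_forall key) (Continuous.intervalIntegrable (by fun_prop) _ _)
  refine hb.trans ?_
  have hd : ∀ s ∈ uIcc (0 : ℝ) 1, HasDerivAt (fun s : ℝ => -((s + 1 / n) * exp (-(n * s))))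
      (n * s * exp (-(n * s))) s := by
    intro s _
    have h2 : HasDerivAt (fun s : ℝ => -(n * s)) (-n) s := by
      simpa using ((hasDerivAt_id s).const_mul (n : ℝ)).fun_neg
    refine (((hasDerivAt_id s).add_const (1 / (n : ℝ))).fun_mul h2.exp).fun_neg.congr_deriv ?_
    simp only [id]
    field_simp
    ring
  rw [intervalIntegral.integral_eq_sub_of_hasDerivAt hd
    (Continuous.intervalIntegrable (by fun_prop) _ _)]
  have : 0 ≤ (1 + 1 / (n : ℝ)) * exp (-(n * 1)) := by positivity
  simp only [zero_add, mul_zero, neg_zero, exp_zero]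
  linarith

lemma tendsto_ein_sub_log :
    Tendsto (fun n : ℕ => (∫ t in 0..(n : ℝ), (1 - exp (-t)) / t) - log n) atTop
      (𝓝 eulerMascheroniConstant) := by
  have h0 : Tendsto (fun n : ℕ => (harmonic n : ℝ) - ∫ t in 0..(n : ℝ), (1 - exp (-t)) / t)
      atTop (𝓝 0) := by
    refine squeeze_zero_norm' ?_ tendsto_one_div_atTop_nhds_zero_nat
    filter_upwards [eventually_gt_atTop 0] with n hn
    exact abs_harmonic_sub_ein_le hn
  have h := tendsto_eulerMascheroniSeq'.sub h0
  rw [sub_zero] at h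
  refine h.congr' ?_
  filter_upwards [eventually_ne_atTop 0] with n hn
  rw [eulerMascheroniSeq', if_neg hn]
  ring

lemma abs_ein_sub_le {T : ℝ} (hT : 0 < T) :
    |(∫ t in 0..T, (1 - exp (-t)) / t) - (log T + eulerMascheroniConstant)| ≤ exp (-T) / T := by
  have hlim : Tendsto (fun n : ℕ => |(∫ t in 0..T, (1 - exp (-t)) / t) - (log T +
      ((∫ t in 0..(n : ℝ), (1 - exp (-t)) / t) - log n))|) atTop
      (𝓝 |(∫ t in 0..T, (1 - exp (-t)) / t) - (log T + eulerMascheroniConstant)|) :=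
    (tendsto_const_nhds.sub (tendsto_const_nhds.add tendsto_ein_sub_log)).abs
  refine le_of_tendsto hlim ?_
  filter_upwards [eventually_ge_atTop ⌈T⌉₊] with n hn
  have hTn : T ≤ n := Nat.ceil_le.1 hn
  have hn0 : (0 : ℝ) < n := hT.trans_le hTn
  have hpos : ∀ t ∈ uIcc T (n : ℝ), t ≠ 0 := by
    intro t ht
    rw [uIcc_of_le hTn] at ht
    exact (hT.trans_le ht.1).ne'
  have ie : IntervalIntegrable (fun t : ℝ => exp (-t) / t) volume T n :=
    ContinuousOn.intervalIntegrable
      ((by fun_prop : Continuous fun t : ℝ => exp (-t)).continuousOn.div continuousOn_id hpos)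
  have io : IntervalIntegrable (fun t : ℝ => 1 / t) volume T n :=
    ContinuousOn.intervalIntegrable (continuousOn_const.div continuousOn_id hpos)
  have hsplit := intervalIntegral.integral_add_adjacent_intervals
    (intervalIntegrable_ein le_rfl hT.le) (intervalIntegrable_ein hT.le hTn)
  have h2 : ∫ t in T..(n : ℝ), (1 - exp (-t)) / t
      = log n - log T - ∫ t in T..(n : ℝ), exp (-t) / t := by
    simp_rw [sub_div]
    rw [intervalIntegral.integral_sub io ie, integral_one_div_of_pos hT hn0,
      log_div hn0.ne' hT.ne']
  have e : (∫ t in 0..T, (1 - exp (-t)) / t) - (log T +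
      ((∫ t in 0..(n : ℝ), (1 - exp (-t)) / t) - log n)) = ∫ t in T..(n : ℝ), exp (-t) / t := by
    rw [← hsplit, h2]; ring
  rw [e]
  have key : ∀ t ∈ Ioc T (n : ℝ), ‖exp (-t) / t‖ ≤ exp (-t) / T := by
    intro t ht
    have ht0 := hT.trans ht.1
    rw [norm_eq_abs, abs_of_pos (by positivity)]
    gcongr
    exact ht.1.le
  have hb := intervalIntegral.norm_integral_le_of_norm_le (μ := volume) hTn
    (Eventually.of_forall key) (Continuous.intervalIntegrable (by fun_prop) _ _)
  refine hb.trans ?_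
  rw [intervalIntegral.integral_div]
  gcongr
  have hd : ∀ s ∈ uIcc T (n : ℝ), HasDerivAt (fun s : ℝ => -exp (-s)) (exp (-s)) s := by
    intro s _
    simpa using (hasDerivAt_neg s).exp.fun_neg
  rw [intervalIntegral.integral_eq_sub_of_hasDerivAt hd
    (Continuous.intervalIntegrable (by fun_prop) _ _)]
  have := exp_pos (-(n : ℝ))
  linarith

lemma integral_sin_mul_left {θ : ℝ} (hθ : θ ≠ 0) (x : ℝ) :
    ∫ s in 0..x, sin (s * θ) = (1 - cos (x * θ)) / θ := by
  rw [intervalIntegral.integral_comp_mul_right (fun u => sin u) hθ, integral_sin, zero_mul,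
    cos_zero, smul_eq_mul, inv_mul_eq_div]

lemma integral_one_sub_cos_div (Y x : ℝ) :
    ∫ θ in 0..π, (1 - cos (x * θ)) / θ * exp (-(Y * θ))
      = ∫ s in 0..x, ∫ θ in 0..π, sin (s * θ) * exp (-(Y * θ)) := by
  rw [intervalIntegral_intervalIntegral_swap]
  · refine integral_congr_Ioc pi_pos.le fun θ hθ => ?_
    rw [intervalIntegral.integral_mul_const, integral_sin_mul_left hθ.1.ne']
  · have hc : Continuous (Function.uncurry fun s θ : ℝ => sin (s * θ) * exp (-(Y * θ))) := by
      unfold Function.uncurry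
      fun_prop
    refine (hc.continuousOn.integrableOn_compact
      (isCompact_uIcc.prod isCompact_uIcc)).mono_set
      (Set.prod_mono uIoc_subset_uIcc uIoc_subset_uIcc)

lemma abs_integral_one_sub_cos_div_sub_le {Y : ℝ} (hY : 0 < Y) (x : ℝ) :
    |(∫ θ in 0..π, (1 - cos (x * θ)) / θ * exp (-(Y * θ)))
      - (log (x ^ 2 + Y ^ 2) / 2 - log Y)| ≤ exp (-(Y * π)) * (2 / Y) * |x| := by
  have hd : ∀ s ∈ uIcc 0 x, HasDerivAt (fun s : ℝ => log (s ^ 2 + Y ^ 2) / 2)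
      (s / (s ^ 2 + Y ^ 2)) s := by
    intro s _
    have hp : s ^ 2 + Y ^ 2 ≠ 0 := by positivity
    refine ((((hasDerivAt_pow 2 s).add_const (Y ^ 2)).log hp).div_const 2).congr_deriv ?_
    field_simp
    norm_num
    ring
  have hc : Continuous fun s : ℝ => s / (s ^ 2 + Y ^ 2) :=
    continuous_id.div (by fun_prop) fun s => by positivity
  have h1 : ∫ s in 0..x, s / (s ^ 2 + Y ^ 2) = log (x ^ 2 + Y ^ 2) / 2 - log Y := by
    rw [intervalIntegral.integral_eq_sub_of_hasDerivAt hd (hc.intervalIntegrable _ _)]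
    simp only [ne_eq, OfNat.ofNat_ne_zero, not_false_eq_true, zero_pow, zero_add, log_pow]
    push_cast
    ring
  have hc2 : Continuous fun s : ℝ => ∫ θ in 0..π, sin (s * θ) * exp (-(Y * θ)) :=
    intervalIntegral.continuous_parametric_intervalIntegral_of_continuous'
      (by unfold Function.uncurry; fun_prop) _ _
  rw [integral_one_sub_cos_div, ← h1, ← intervalIntegral.integral_sub
    (hc2.intervalIntegrable _ _) (hc.intervalIntegrable _ _)]
  have := intervalIntegral.norm_integral_le_of_norm_le_const (a := 0) (b := x)
    (f := fun s => (∫ θ in 0..π, sin (s * θ) * exp (-(Y * θ))) - s / (s ^ 2 + Y ^ 2))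
    (fun s _ => abs_integral_sin_mul_exp_sub_le hY s)
  rwa [sub_zero] at this

lemma abs_one_sub_cos_le (u : ℝ) : |1 - cos u| ≤ |u| := by
  have h1 := cos_le_one u
  have h2 := one_sub_sq_div_two_le_cos (x := u)
  have h3 := neg_one_le_cos u
  rw [abs_of_nonneg (by linarith)]
  rcases le_total |u| 2 with h | h
  · have : u ^ 2 = |u| * |u| := by rw [← sq, sq_abs]
    nlinarith [abs_nonneg u]
  · linarith

lemma abs_integral_one_sub_cos_mul_exp_div_sub_le {Y : ℝ} (hY : 0 < Y) (x : ℝ) :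
    |(∫ θ in 0..π, (1 - cos (x * θ) * exp (-(Y * θ))) / θ)
      - (log π + eulerMascheroniConstant + log (x ^ 2 + Y ^ 2) / 2)|
      ≤ exp (-(Y * π)) * (1 / Y + 2 / Y * |x|) := by
  have i1 : IntervalIntegrable (fun θ : ℝ => (1 - exp (-(Y * θ))) / θ) volume 0 π := by
    refine intervalIntegrable_of_bounded (M := Y) (by fun_prop) pi_pos.le fun θ hθ => ?_
    have h := abs_ein_integrand_le (mul_pos hY hθ.1)
    have e : (1 - exp (-(Y * θ))) / θ = Y * ((1 - exp (-(Y * θ))) / (Y * θ)) := by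
      have := hθ.1.ne'
      field_simp
    rw [e, abs_mul, abs_of_pos hY]
    exact mul_le_of_le_one_right hY.le h
  have i2 : IntervalIntegrable (fun θ : ℝ => (1 - cos (x * θ)) / θ * exp (-(Y * θ)))
      volume 0 π := by
    refine intervalIntegrable_of_bounded (M := |x|) (by fun_prop) pi_pos.le fun θ hθ => ?_
    have h := abs_one_sub_cos_le (x * θ)
    have h2 : exp (-(Y * θ)) ≤ 1 := exp_le_one_iff.2 (by have := mul_pos hY hθ.1; linarith)
    rw [abs_mul, abs_of_pos (exp_pos _)]
    refine (mul_le_of_le_one_right (abs_nonneg _) h2).trans ?_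
    rw [abs_div, abs_of_pos hθ.1, div_le_iff₀ hθ.1]
    rwa [abs_mul, abs_of_pos hθ.1] at h
  have hsplit : ∫ θ in 0..π, (1 - cos (x * θ) * exp (-(Y * θ))) / θ
      = (∫ θ in 0..π, (1 - exp (-(Y * θ))) / θ)
        + ∫ θ in 0..π, (1 - cos (x * θ)) / θ * exp (-(Y * θ)) := by
    rw [← intervalIntegral.integral_add i1 i2]
    congr 1
    ext θ
    ring
  have hYp := mul_pos hY pi_pos
  have h1 := abs_ein_sub_le hYp
  have h2 := abs_integral_one_sub_cos_div_sub_le hY x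
  rw [hsplit, integral_ein_scale hY]
  rw [log_mul hY.ne' pi_pos.ne'] at h1
  have h3 : exp (-(Y * π)) / (Y * π) ≤ exp (-(Y * π)) * (1 / Y) := by
    rw [div_eq_mul_one_div]
    gcongr
    exact le_mul_of_one_le_right hY.le (by linarith [pi_gt_three])
  rw [abs_le] at *
  constructor <;> linarith [h1.1, h1.2, h2.1, h2.2]

end Ein

section Asymptotics

variable {k : ℝ}

lemma sinh_rate_pos (hk : 0 < k) {θ : ℝ} (h0 : 0 < θ) (h1 : θ ≤ π) : 0 < sinh (rate k θ) :=
  sinh_pos_iff.2 (rate_pos hk h0 h1)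

lemma measurable_rate (k : ℝ) : Measurable (rate k) := (continuous_rate k).measurable

lemma measurable_sinh_rate (k : ℝ) : Measurable fun θ => sinh (rate k θ) :=
  (continuous_sinh.comp (continuous_rate k)).measurable

lemma measurable_exp_rate (k y : ℝ) : Measurable fun θ => exp (-(y * rate k θ)) :=
  (measurable_exp.comp ((measurable_rate k).const_mul y).neg)

lemma intervalIntegrable_inv_sinh_sub (hk : 0 < k) :
    IntervalIntegrable (fun θ => 1 / sinh (rate k θ) - 1 / (k * θ)) volume 0 π := by
  have hm := measurable_sinh_rate k
  refine intervalIntegrable_of_bounded (M := (k + 2 / k) * π) (by fun_prop) pi_pos.le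
    fun θ hθ => (abs_inv_sinh_rate_sub_le hk hθ.1 hθ.2).trans ?_
  gcongr
  exact hθ.2

lemma hasDerivAt_sin_half (θ : ℝ) : HasDerivAt (fun θ => sin (θ / 2)) (cos (θ / 2) / 2) θ := by
  simpa [div_eq_mul_inv] using ((hasDerivAt_id θ).div_const 2).sin

lemma hasDerivAt_cos_half (θ : ℝ) : HasDerivAt (fun θ => cos (θ / 2)) (-sin (θ / 2) / 2) θ := by
  simpa [div_eq_mul_inv] using ((hasDerivAt_id θ).div_const 2).cos

lemma hasDerivAt_sqrt_sin_half (k θ : ℝ) :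
    HasDerivAt (fun θ => √(1 + (k * sin (θ / 2)) ^ 2))
      (k ^ 2 * sin (θ / 2) * cos (θ / 2) / (2 * √(1 + (k * sin (θ / 2)) ^ 2))) θ := by
  have hp : 1 + (k * sin (θ / 2)) ^ 2 ≠ 0 := by positivity
  refine (((((hasDerivAt_sin_half θ).const_mul k).fun_pow 2).const_add 1).sqrt hp).congr_deriv ?_
  congr 1
  push_cast
  ring

lemma integral_inv_sinh_sub (hk : 0 < k) :
    ∫ θ in 0..π, (1 / sinh (rate k θ) - 1 / (k * θ))
      = (log 4 - log (1 + k ^ 2) / 2 - log π) / k := by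
  set Φ : ℝ → ℝ := fun θ =>
    (log (sin (θ / 2) / θ) - log (√(1 + (k * sin (θ / 2)) ^ 2) + cos (θ / 2))) / k with hΦ
  have hd : ∀ θ ∈ Ioo 0 π, HasDerivAt Φ (1 / sinh (rate k θ) - 1 / (k * θ)) θ := by
    intro θ hθ
    have hs : 0 < sin (θ / 2) := sin_half_pos hθ.1 hθ.2.le
    have hc : 0 < cos (θ / 2) :=
      cos_pos_of_mem_Ioo ⟨by linarith [hθ.1, pi_pos], by linarith [hθ.2]⟩
    have h0 := hθ.1
    have hq : 0 < √(1 + (k * sin (θ / 2)) ^ 2) := by positivity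
    refine (((((hasDerivAt_sin_half θ).fun_div (hasDerivAt_id θ) h0.ne').log
      (by simp only [id]; positivity)).fun_sub
      (((hasDerivAt_sqrt_sin_half k θ).fun_add (hasDerivAt_cos_half θ)).log
        (by positivity))).div_const k).congr_deriv ?_
    have hq2 : √(1 + (k * sin (θ / 2)) ^ 2) ^ 2 = 1 + (k * sin (θ / 2)) ^ 2 :=
      sq_sqrt (by positivity)
    have hsc : cos (θ / 2) ^ 2 = 1 - sin (θ / 2) ^ 2 := cos_sq' (θ / 2)
    rw [sinh_rate]
    set s := sin (θ / 2)
    set c := cos (θ / 2)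
    set q := √(1 + (k * s) ^ 2)
    have hqc : q + c ≠ 0 := by positivity
    simp only [id]
    field_simp
    linear_combination (θ * c) * hq2 + (θ * q) * hsc
  have h0 : Tendsto Φ (𝓝[>] 0) (𝓝 ((log (1 / 2) - log 2) / k)) := by
    refine Tendsto.div_const (Tendsto.sub ?_ ?_) k
    · refine Tendsto.log ?_ (by norm_num)
      have h := hasDerivAt_iff_tendsto_slope.1 (hasDerivAt_sin_half 0)
      rw [zero_div, cos_zero] at h
      refine (h.mono_left (nhdsGT_le_nhdsNE 0)).congr fun θ => ?_
      simp [slope_def_field]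
    · have hc : ContinuousAt
          (fun θ => log (√(1 + (k * sin (θ / 2)) ^ 2) + cos (θ / 2))) 0 := by
        refine ContinuousAt.log (by fun_prop) ?_
        norm_num
      have h := hc.tendsto.mono_left (nhdsWithin_le_nhds (s := Ioi 0))
      norm_num at h
      exact h
  have h1 : Tendsto Φ (𝓝[<] π) (𝓝 ((-log π - log (1 + k ^ 2) / 2) / k)) := by
    have hc : ContinuousAt Φ π := by
      refine ContinuousAt.div_const (ContinuousAt.sub (ContinuousAt.log ?_ ?_)
        (ContinuousAt.log (by fun_prop) ?_)) k
      · exact ContinuousAt.div (by fun_prop) continuousAt_id pi_ne_zero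
      · simp [pi_ne_zero]
      · simp only [sin_pi_div_two, cos_pi_div_two]
        positivity
    have h := hc.tendsto.mono_left (nhdsWithin_le_nhds (s := Iio π))
    convert h using 2
    simp only [hΦ, sin_pi_div_two, cos_pi_div_two, mul_one, add_zero, one_div, log_inv]
    rw [log_sqrt (by positivity)]
  rw [intervalIntegral.integral_eq_sub_of_hasDerivAt_of_tendsto pi_pos hd
    (intervalIntegrable_inv_sinh_sub hk) h0 h1]
  have h4 : log 4 = 2 * log 2 := by
    rw [show (4 : ℝ) = 2 ^ 2 by norm_num, log_pow]; norm_num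
  rw [h4, one_div, log_inv]
  ring

/-- The normalized lattice Green's function as a Fourier integral in the first variable. -/
noncomputable def green (k x y : ℝ) : ℝ :=
  ∫ θ in 0..π, (1 - cos (x * θ) * exp (-(y * rate k θ))) / sinh (rate k θ)

lemma measurable_green_integrand (k x y : ℝ) :
    Measurable fun θ => (1 - cos (x * θ) * exp (-(y * rate k θ))) / sinh (rate k θ) := by
  have := measurable_sinh_rate k
  have := measurable_exp_rate k y
  fun_prop

lemma intervalIntegrable_green (hk : 0 < k) (x : ℝ) {y : ℝ} (hy : 0 ≤ y) :
    IntervalIntegrable (fun θ => (1 - cos (x * θ) * exp (-(y * rate k θ))) / sinh (rate k θ))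
      volume 0 π := by
  refine intervalIntegrable_of_bounded (M := |x| * (π / (2 * k)) + y)
    (measurable_green_integrand k x y) pi_pos.le fun θ hθ => ?_
  have hS := sinh_rate_pos hk hθ.1 hθ.2
  have hSl := sinh_rate_lower hk hθ.1.le hθ.2
  have hr := rate_pos hk hθ.1 hθ.2
  have hrs := self_le_sinh_iff.2 hr.le
  rw [abs_div, abs_of_pos hS, div_le_iff₀ hS]
  have e : 1 - cos (x * θ) * exp (-(y * rate k θ))
      = (1 - cos (x * θ)) + cos (x * θ) * (1 - exp (-(y * rate k θ))) := by ring
  have h1 : |1 - cos (x * θ)| ≤ |x| * θ := by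
    have := abs_one_sub_cos_le (x * θ)
    rwa [abs_mul, abs_of_pos hθ.1] at this
  have h2 : |cos (x * θ) * (1 - exp (-(y * rate k θ)))| ≤ y * rate k θ := by
    rw [abs_mul]
    have h3 := one_sub_le_exp_neg (y * rate k θ)
    have h4 : exp (-(y * rate k θ)) ≤ 1 :=
      exp_le_one_iff.2 (neg_nonpos.2 (mul_nonneg hy hr.le))
    refine (mul_le_of_le_one_left (abs_nonneg _) (abs_cos_le_one _)).trans ?_
    rw [abs_of_nonneg (by linarith)]
    linarith
  rw [e]
  refine (abs_add_le _ _).trans ?_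
  rw [add_mul]
  refine add_le_add (h1.trans ?_) (h2.trans (by gcongr))
  rw [mul_assoc]
  gcongr
  calc θ = π / (2 * k) * (2 * k / π * θ) := by
        have := pi_ne_zero
        field_simp
    _ ≤ _ := by gcongr

lemma green_asymptotics (hk : 0 < k) : ∃ C : ℝ, 0 ≤ C ∧ ∀ x y : ℝ, 1 ≤ y → |x| ≤ y →
    |green k x y - (log 4 - log (1 + k ^ 2) / 2 + eulerMascheroniConstant
      + log (x ^ 2 + (k * y) ^ 2) / 2) / k| ≤ C / y ^ 2 := by
  obtain ⟨K, hK, hKf⟩ := abs_integral_le_of_decay 1 (rateConst_pos hk)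
  set M := (1 + k ^ 2) + (k + 2 / k) with hM
  have hM0 : 0 ≤ M := by positivity
  refine ⟨M * K + (3 / k) * (Nat.factorial 2 / (k * π) ^ 2) / k, by positivity,
    fun x y hy hxy => ?_⟩
  have hy0 : 0 < y := by linarith
  have hY : 0 < k * y := by positivity
  have iA := intervalIntegrable_inv_sinh_sub hk
  have iG := intervalIntegrable_green hk x hy0.le
  have iB : IntervalIntegrable
      (fun θ => 1 / k * ((1 - cos (x * θ) * exp (-(k * y * θ))) / θ)) volume 0 π := by
    refine IntervalIntegrable.const_mul ?_ _
    refine intervalIntegrable_of_bounded (M := |x| + k * y) (by fun_prop) pi_pos.le fun θ hθ => ?_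
    rw [abs_div, abs_of_pos hθ.1, div_le_iff₀ hθ.1]
    have e : 1 - cos (x * θ) * exp (-(k * y * θ))
      = (1 - cos (x * θ)) + cos (x * θ) * (1 - exp (-(k * y * θ))) := by ring
    have h1 : |1 - cos (x * θ)| ≤ |x| * θ := by
      have := abs_one_sub_cos_le (x * θ)
      rwa [abs_mul, abs_of_pos hθ.1] at this
    have h2 : |cos (x * θ) * (1 - exp (-(k * y * θ)))| ≤ k * y * θ := by
      rw [abs_mul]
      have h3 := one_sub_le_exp_neg (k * y * θ)
      have h4 : exp (-(k * y * θ)) ≤ 1 :=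
        exp_le_one_iff.2 (neg_nonpos.2 (mul_nonneg hY.le hθ.1.le))
      refine (mul_le_of_le_one_left (abs_nonneg _) (abs_cos_le_one _)).trans ?_
      rw [abs_of_nonneg (by linarith)]
      linarith
    rw [e, add_mul]
    exact (abs_add_le _ _).trans (add_le_add h1 h2)
  have hE := hKf y M (fun θ => (1 - cos (x * θ) * exp (-(y * rate k θ))) / sinh (rate k θ)
      - (1 / sinh (rate k θ) - 1 / (k * θ))
      - 1 / k * ((1 - cos (x * θ) * exp (-(k * y * θ))) / θ)) hy0 hM0 (fun θ hθ => by
    have h0 := hθ.1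
    have hS := sinh_rate_pos hk hθ.1 hθ.2
    have e : (1 - cos (x * θ) * exp (-(y * rate k θ))) / sinh (rate k θ)
        - (1 / sinh (rate k θ) - 1 / (k * θ))
        - 1 / k * ((1 - cos (x * θ) * exp (-(k * y * θ))) / θ)
        = cos (x * θ) * (-((exp (-(y * rate k θ)) - exp (-(y * (k * θ)))) / (k * θ))
          - exp (-(y * rate k θ)) * (1 / sinh (rate k θ) - 1 / (k * θ))) := by
      rw [show k * y * θ = y * (k * θ) by ring]
      field_simp
      ring
    rw [e, abs_mul]
    refine (mul_le_of_le_one_left (abs_nonneg _) (abs_cos_le_one _)).trans ?_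
    refine (abs_sub _ _).trans ?_
    have b1 := abs_exp_rate_sub_le hk h0.le hθ.2 hy0.le
    have b2 := abs_inv_sinh_rate_sub_le hk h0 hθ.2
    have b3 := exp_rate_le hk h0.le hθ.2 hy0.le
    rw [abs_neg, abs_div, abs_of_pos (by positivity : 0 < k * θ), abs_mul,
      abs_of_pos (exp_pos _)]
    set ε := exp (-(rateConst k * (y * θ)))
    have hε : 0 < ε := exp_pos _
    have c1 : |exp (-(y * rate k θ)) - exp (-(y * (k * θ)))| / (k * θ)
        ≤ (1 + k ^ 2) * (y * θ ^ 2 * ε) := by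
      rw [div_le_iff₀ (by positivity)]
      refine b1.trans (le_of_eq ?_)
      ring
    have c2 : exp (-(y * rate k θ)) * |1 / sinh (rate k θ) - 1 / (k * θ)|
        ≤ ε * ((k + 2 / k) * θ) := by gcongr
    refine (add_le_add c1 c2).trans ?_
    have d1 : 0 ≤ (1 + k ^ 2) * (θ * ε) := by positivity
    have d2 : 0 ≤ (k + 2 / k) * (y * θ ^ 2 * ε) := by positivity
    rw [hM]
    nlinarith [d1, d2])
  rw [intervalIntegral.integral_sub (iG.sub iA) iB, intervalIntegral.integral_sub iG iA,
    intervalIntegral.integral_const_mul, integral_inv_sinh_sub hk] at hE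
  have hB := abs_integral_one_sub_cos_mul_exp_div_sub_le hY x
  set B := ∫ θ in 0..π, (1 - cos (x * θ) * exp (-(k * y * θ))) / θ
  have hsmall : exp (-(k * y * π)) * (1 / (k * y) + 2 / (k * y) * |x|)
      ≤ (3 / k) * (Nat.factorial 2 / (k * π) ^ 2) / y ^ 2 := by
    have h1 := pow_mul_exp_neg_le 2 (by positivity : 0 < k * π) hy0.le
    have h2 : 1 / (k * y) + 2 / (k * y) * |x| ≤ 3 / k := by
      have : 1 / (k * y) + 2 / (k * y) * |x| = (1 + 2 * |x|) / (k * y) := by ring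
      rw [this, div_le_div_iff₀ hY hk]
      nlinarith
    rw [le_div_iff₀ (by positivity)]
    calc exp (-(k * y * π)) * (1 / (k * y) + 2 / (k * y) * |x|) * y ^ 2
        = (1 / (k * y) + 2 / (k * y) * |x|) * (y ^ 2 * exp (-(k * π * y))) := by
          rw [show k * π * y = k * y * π by ring]; ring
      _ ≤ _ := by gcongr
  have hB' := hB.trans hsmall
  have e : green k x y - (log 4 - log (1 + k ^ 2) / 2 + eulerMascheroniConstant
      + log (x ^ 2 + (k * y) ^ 2) / 2) / k
      = (green k x y - (log 4 - log (1 + k ^ 2) / 2 - log π) / k - 1 / k * B)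
        + 1 / k * (B - (log π + eulerMascheroniConstant + log (x ^ 2 + (k * y) ^ 2) / 2)) := by
    ring
  rw [e]
  refine (abs_add_le _ _).trans ?_
  rw [add_div]
  refine add_le_add hE ?_
  rw [abs_mul, abs_of_pos (by positivity : 0 < 1 / k)]
  calc 1 / k * |B - (log π + eulerMascheroniConstant + log (x ^ 2 + (k * y) ^ 2) / 2)|
      ≤ 1 / k * ((3 / k) * (Nat.factorial 2 / (k * π) ^ 2) / y ^ 2) := by gcongr
    _ = _ := by ring

lemma exp_mul_two_div_le (hk : 0 < k) {y : ℝ} (hy : 0 < y) :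
    exp (-(k * y * π)) * (2 / (k * y)) ≤ 2 / k * (Nat.factorial 2 / (k * π) ^ 2) / y ^ 3 := by
  have h1 := pow_mul_exp_neg_le 2 (by positivity : 0 < k * π) hy.le
  rw [le_div_iff₀ (by positivity)]
  calc exp (-(k * y * π)) * (2 / (k * y)) * y ^ 3
      = 2 / k * (y ^ 2 * exp (-(k * π * y))) := by
        rw [show k * π * y = k * y * π by ring]; field_simp
    _ ≤ _ := by gcongr

lemma integral_cos_mul_exp_rate_asymptotics (hk : 0 < k) : ∃ C : ℝ, 0 ≤ C ∧ ∀ x y : ℝ, 0 < y →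
    |(∫ θ in 0..π, cos (x * θ) * exp (-(y * rate k θ))) - k * y / (x ^ 2 + (k * y) ^ 2)|
      ≤ C / y ^ 3 := by
  obtain ⟨K, hK, hKf⟩ := abs_integral_le_of_decay 2 (rateConst_pos hk)
  set M := k + k ^ 3 with hM
  have hM0 : 0 ≤ M := by positivity
  refine ⟨M * K + 2 / k * (Nat.factorial 2 / (k * π) ^ 2), by positivity, fun x y hy0 => ?_⟩
  have hY : 0 < k * y := by positivity
  have i1 : IntervalIntegrable (fun θ => cos (x * θ) * exp (-(y * rate k θ))) volume 0 π := by
    have := continuous_rate k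
    exact Continuous.intervalIntegrable (by fun_prop) _ _
  have i2 : IntervalIntegrable (fun θ => cos (x * θ) * exp (-(k * y * θ))) volume 0 π :=
    Continuous.intervalIntegrable (by fun_prop) _ _
  have hE := hKf y M (fun θ => cos (x * θ) * exp (-(y * rate k θ))
      - cos (x * θ) * exp (-(k * y * θ))) hy0 hM0 (fun θ hθ => by
    have h0 := hθ.1
    rw [← mul_sub, abs_mul]
    refine (mul_le_of_le_one_left (abs_nonneg _) (abs_cos_le_one _)).trans ?_
    rw [show k * y * θ = y * (k * θ) by ring]
    refine (abs_exp_rate_sub_le hk h0.le hθ.2 hy0.le).trans ?_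
    rw [mul_assoc M]
    refine mul_le_mul_of_nonneg_left ?_ hM0
    refine mul_le_mul_of_nonneg_right ?_ (exp_pos _).le
    nlinarith [sq_nonneg θ])
  rw [intervalIntegral.integral_sub i1 i2] at hE
  have hB := (abs_integral_cos_mul_exp_sub_le hY x).trans (exp_mul_two_div_le hk hy0)
  rw [add_div]
  exact (abs_sub_le _ _ _).trans (add_le_add hE hB)

lemma abs_sin_div_sinh_rate_sub_le (hk : 0 < k) {θ : ℝ} (h0 : 0 < θ) (h1 : θ ≤ π) :
    |sin θ / sinh (rate k θ) - 1 / k| ≤ (k + 3 / k) * θ ^ 2 := by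
  have b := abs_inv_sinh_rate_sub_le hk h0 h1
  have hs0 : 0 ≤ sin θ := sin_nonneg_of_nonneg_of_le_pi h0.le h1
  have hs1 := sin_le h0.le
  have hs2 := sin_ge_sub_cube h0.le
  have e : sin θ / sinh (rate k θ) - 1 / k
      = sin θ * (1 / sinh (rate k θ) - 1 / (k * θ)) - (θ - sin θ) / (k * θ) := by
    field_simp
    ring
  rw [e]
  refine (abs_sub _ _).trans ?_
  rw [abs_mul, abs_of_nonneg hs0,
    abs_of_nonneg (show 0 ≤ (θ - sin θ) / (k * θ) from div_nonneg (by linarith) (by positivity))]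
  have c1 : sin θ * |1 / sinh (rate k θ) - 1 / (k * θ)| ≤ θ * ((k + 2 / k) * θ) := by gcongr
  have c2 : (θ - sin θ) / (k * θ) ≤ 1 / k * θ ^ 2 := by
    rw [div_le_iff₀ (by positivity)]
    have : 1 / k * θ ^ 2 * (k * θ) = θ ^ 3 := by field_simp
    have := pow_pos h0 3
    linarith
  refine (add_le_add c1 c2).trans (le_of_eq ?_)
  ring

lemma integral_sin_mul_exp_rate_asymptotics (hk : 0 < k) : ∃ C : ℝ, 0 ≤ C ∧ ∀ x y : ℝ, 0 < y →
    |(∫ θ in 0..π, sin (x * θ) * (sin θ / sinh (rate k θ)) * exp (-(y * rate k θ)))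
      - x / (x ^ 2 + (k * y) ^ 2) / k| ≤ C / y ^ 3 := by
  obtain ⟨K, hK, hKf⟩ := abs_integral_le_of_decay 2 (rateConst_pos hk)
  set M := (k + 3 / k) + (1 + k ^ 2) with hM
  have hM0 : 0 ≤ M := by positivity
  refine ⟨M * K + 2 / k * (Nat.factorial 2 / (k * π) ^ 2) / k, by positivity,
    fun x y hy0 => ?_⟩
  have hY : 0 < k * y := by positivity
  have i1 : IntervalIntegrable
      (fun θ => sin (x * θ) * (sin θ / sinh (rate k θ)) * exp (-(y * rate k θ))) volume 0 π := by
    have := measurable_sinh_rate k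
    have := measurable_exp_rate k y
    refine intervalIntegrable_of_bounded (M := (k + 3 / k) * π ^ 2 + 1 / k) (by fun_prop)
      pi_pos.le fun θ hθ => ?_
    have h1 : |sin θ / sinh (rate k θ)| ≤ (k + 3 / k) * π ^ 2 + 1 / k := by
      have h2 := abs_sin_div_sinh_rate_sub_le hk hθ.1 hθ.2
      have h3 : (k + 3 / k) * θ ^ 2 ≤ (k + 3 / k) * π ^ 2 := by
        have := hθ.1.le
        have := hθ.2
        gcongr
      have h4 := abs_sub_abs_le_abs_sub (sin θ / sinh (rate k θ)) (1 / k)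
      rw [abs_of_pos (by positivity : 0 < 1 / k)] at h4
      linarith
    have h5 : exp (-(y * rate k θ)) ≤ 1 :=
      exp_le_one_iff.2 (neg_nonpos.2 (mul_nonneg hy0.le (rate_pos hk hθ.1 hθ.2).le))
    rw [abs_mul, abs_mul, abs_of_pos (exp_pos _)]
    calc |sin (x * θ)| * |sin θ / sinh (rate k θ)| * exp (-(y * rate k θ))
        ≤ 1 * |sin θ / sinh (rate k θ)| * 1 := by
          gcongr
          exact abs_sin_le_one _
      _ ≤ _ := by rwa [one_mul, mul_one]
  have i2 : IntervalIntegrable (fun θ => 1 / k * (sin (x * θ) * exp (-(k * y * θ)))) volume 0 π :=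
    Continuous.intervalIntegrable (by fun_prop) _ _
  have hE := hKf y M
    (fun θ => sin (x * θ) * (sin θ / sinh (rate k θ)) * exp (-(y * rate k θ))
      - 1 / k * (sin (x * θ) * exp (-(k * y * θ)))) hy0 hM0 (fun θ hθ => by
    have h0 := hθ.1
    have e : sin (x * θ) * (sin θ / sinh (rate k θ)) * exp (-(y * rate k θ))
        - 1 / k * (sin (x * θ) * exp (-(k * y * θ)))
        = sin (x * θ) * ((sin θ / sinh (rate k θ) - 1 / k) * exp (-(y * rate k θ))
          + 1 / k * (exp (-(y * rate k θ)) - exp (-(y * (k * θ))))) := by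
      rw [show k * y * θ = y * (k * θ) by ring]
      ring
    rw [e, abs_mul]
    refine (mul_le_of_le_one_left (abs_nonneg _) (abs_sin_le_one _)).trans ?_
    refine (abs_add_le _ _).trans ?_
    have b1 := abs_exp_rate_sub_le hk h0.le hθ.2 hy0.le
    have b2 := abs_sin_div_sinh_rate_sub_le hk h0 hθ.2
    have b3 := exp_rate_le hk h0.le hθ.2 hy0.le
    rw [abs_mul, abs_mul, abs_of_pos (exp_pos _), abs_of_pos (by positivity : 0 < 1 / k)]
    set ε := exp (-(rateConst k * (y * θ)))
    have hε : 0 < ε := exp_pos _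
    have c1 : |sin θ / sinh (rate k θ) - 1 / k| * exp (-(y * rate k θ))
        ≤ (k + 3 / k) * θ ^ 2 * ε := by gcongr
    have c2 : 1 / k * |exp (-(y * rate k θ)) - exp (-(y * (k * θ)))|
        ≤ 1 / k * ((k + k ^ 3) * (y * θ ^ 3) * ε) := by gcongr
    have e2 : 1 / k * ((k + k ^ 3) * (y * θ ^ 3) * ε) = (1 + k ^ 2) * (y * θ ^ 3 * ε) := by
      field_simp
    rw [e2] at c2
    refine (add_le_add c1 c2).trans ?_
    have d1 : 0 ≤ (1 + k ^ 2) * (θ ^ 2 * ε) := by positivity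
    have d2 : 0 ≤ (k + 3 / k) * (y * θ ^ 3 * ε) := by positivity
    rw [hM]
    nlinarith [d1, d2])
  rw [intervalIntegral.integral_sub i1 i2, intervalIntegral.integral_const_mul] at hE
  have hB := (abs_integral_sin_mul_exp_sub_le hY x).trans (exp_mul_two_div_le hk hy0)
  set B := ∫ θ in 0..π, sin (x * θ) * exp (-(k * y * θ))
  have hB2 : |1 / k * B - x / (x ^ 2 + (k * y) ^ 2) / k|
      ≤ 2 / k * (Nat.factorial 2 / (k * π) ^ 2) / k / y ^ 3 := by
    have e : 1 / k * B - x / (x ^ 2 + (k * y) ^ 2) / k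
        = 1 / k * (B - x / (x ^ 2 + (k * y) ^ 2)) := by ring
    rw [e, abs_mul, abs_of_pos (by positivity : 0 < 1 / k)]
    calc _ ≤ 1 / k * (2 / k * (Nat.factorial 2 / (k * π) ^ 2) / y ^ 3) := by gcongr
      _ = _ := by ring
  rw [add_div]
  exact (abs_sub_le _ _ _).trans (add_le_add hE hB2)

end Asymptotics

section Poisson

variable {α : ℝ}

lemma cosh_sub_cos_pos (hα : 0 < α) (φ : ℝ) : 0 < cosh α - cos φ := by
  have h1 := one_lt_cosh.2 hα.ne'
  have h2 := cos_le_one φ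
  linarith

lemma continuous_cos_div_cosh_sub_cos (hα : 0 < α) (x : ℝ) :
    Continuous fun φ => cos (x * φ) / (cosh α - cos φ) :=
  Continuous.div (by fun_prop) (by fun_prop) fun φ => (cosh_sub_cos_pos hα φ).ne'

lemma integral_cos_nat_mul {n : ℕ} (hn : n ≠ 0) : ∫ φ in 0..π, cos (n * φ) = 0 := by
  have hn' : (n : ℝ) ≠ 0 := Nat.cast_ne_zero.2 hn
  rw [intervalIntegral.integral_comp_mul_left (fun u => cos u) hn', integral_cos, sin_nat_mul_pi]
  simp

lemma integral_cos_div_cosh_sub_cos_add_two (hα : 0 < α) (n : ℕ) :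
    (∫ φ in 0..π, cos ((n + 2 : ℕ) * φ) / (cosh α - cos φ))
        + ∫ φ in 0..π, cos (n * φ) / (cosh α - cos φ)
      = 2 * cosh α * ∫ φ in 0..π, cos ((n + 1 : ℕ) * φ) / (cosh α - cos φ) := by
  have i (m : ℕ) : IntervalIntegrable (fun φ => cos (m * φ) / (cosh α - cos φ)) volume 0 π :=
    (continuous_cos_div_cosh_sub_cos hα m).intervalIntegrable _ _
  have h0 : ∫ φ in 0..π, -2 * cos ((n + 1 : ℕ) * φ) = 0 := by
    rw [intervalIntegral.integral_const_mul, integral_cos_nat_mul n.succ_ne_zero, mul_zero]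
  rw [← sub_eq_zero, ← intervalIntegral.integral_add (i _) (i _),
    ← intervalIntegral.integral_const_mul,
    ← intervalIntegral.integral_sub ((i _).add (i _)) ((i _).const_mul _)]
  refine (intervalIntegral.integral_congr fun φ _ => ?_).trans h0
  have hp := (cosh_sub_cos_pos hα φ).ne'
  have e2 : ((n + 2 : ℕ) : ℝ) * φ = (n + 1 : ℕ) * φ + φ := by push_cast; ring
  have e0 : (n : ℝ) * φ = (n + 1 : ℕ) * φ - φ := by push_cast; ring
  simp only [e2, e0, cos_add, cos_sub]
  field_simp
  ring

lemma integral_cos_div_cosh_sub_cos_one (hα : 0 < α) :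
    ∫ φ in 0..π, cos ((1 : ℕ) * φ) / (cosh α - cos φ)
      = cosh α * (∫ φ in 0..π, cos ((0 : ℕ) * φ) / (cosh α - cos φ)) - π := by
  have i (m : ℕ) : IntervalIntegrable (fun φ => cos (m * φ) / (cosh α - cos φ)) volume 0 π :=
    (continuous_cos_div_cosh_sub_cos hα m).intervalIntegrable _ _
  have h0 : ∫ _φ in 0..π, (1 : ℝ) = π := by simp
  have h1 : cosh α * (∫ φ in 0..π, cos ((0 : ℕ) * φ) / (cosh α - cos φ)) - π
      = ∫ φ in 0..π, (cosh α * (cos ((0 : ℕ) * φ) / (cosh α - cos φ)) - 1) := by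
    rw [intervalIntegral.integral_sub ((i _).const_mul _) intervalIntegrable_const, h0,
      intervalIntegral.integral_const_mul]
  rw [h1]
  refine intervalIntegral.integral_congr fun φ _ => ?_
  have hp := (cosh_sub_cos_pos hα φ).ne'
  simp only [Nat.cast_one, Nat.cast_zero, one_mul, zero_mul, cos_zero]
  field_simp
  ring

lemma abs_integral_cos_div_cosh_sub_cos_le (hα : 0 < α) (n : ℕ) :
    |∫ φ in 0..π, cos (n * φ) / (cosh α - cos φ)| ≤ 1 / (cosh α - 1) * π := by
  have h1 := one_lt_cosh.2 hα.ne'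
  have h := intervalIntegral.norm_integral_le_of_norm_le_const (a := 0) (b := π)
    (f := fun φ => cos (n * φ) / (cosh α - cos φ)) (C := 1 / (cosh α - 1)) fun φ _ => by
      rw [norm_eq_abs, abs_div, abs_of_pos (cosh_sub_cos_pos hα φ)]
      have h2 := cos_le_one φ
      have h3 := abs_cos_le_one (n * φ)
      have h4 : 0 < cosh α - 1 := by linarith
      gcongr
  rwa [sub_zero, abs_of_pos pi_pos, norm_eq_abs] at h

/-- Fourier coefficients of the Poisson kernel. -/
lemma integral_cos_div_cosh_sub_cos (hα : 0 < α) (n : ℕ) :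
    ∫ φ in 0..π, cos (n * φ) / (cosh α - cos φ) = π * exp (-(n * α)) / sinh α := by
  set I : ℕ → ℝ := fun n => ∫ φ in 0..π, cos (n * φ) / (cosh α - cos φ) with hI
  have hrec (n : ℕ) : I (n + 2) + I n = 2 * cosh α * I (n + 1) :=
    integral_cos_div_cosh_sub_cos_add_two hα n
  have hone : I 1 = cosh α * I 0 - π := integral_cos_div_cosh_sub_cos_one hα
  have hbd (n : ℕ) : |I n| ≤ 1 / (cosh α - 1) * π := abs_integral_cos_div_cosh_sub_cos_le hα n
  have hS : 0 < sinh α := sinh_pos_iff.2 hα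
  have hE : exp α * exp (-α) = 1 := by rw [← exp_add, add_neg_cancel, exp_zero]
  have hd (n : ℕ) : I (n + 1) - exp (-α) * I n = exp α ^ n * (I 1 - exp (-α) * I 0) := by
    induction n with
    | zero => simp
    | succ n ih =>
      rw [pow_succ', mul_assoc, ← ih]
      have h := hrec n
      rw [cosh_eq] at h
      linear_combination h + I n * hE
  have hd0 : I 1 - exp (-α) * I 0 = 0 := by
    by_contra hne
    have hT : Tendsto (fun n : ℕ => exp α ^ n * |I 1 - exp (-α) * I 0|) atTop atTop :=
      (tendsto_pow_atTop_atTop_of_one_lt (one_lt_exp_iff.2 hα)).atTop_mul_const (abs_pos.2 hne)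
    obtain ⟨n, hn⟩ :=
      (hT.eventually (eventually_gt_atTop (2 * (1 / (cosh α - 1) * π)))).exists
    have h1 : exp α ^ n * |I 1 - exp (-α) * I 0| = |I (n + 1) - exp (-α) * I n| := by
      rw [hd n, abs_mul, abs_of_pos (pow_pos (exp_pos α) n)]
    have h2 := abs_sub (I (n + 1)) (exp (-α) * I n)
    rw [abs_mul, abs_of_pos (exp_pos _)] at h2
    have h3 : exp (-α) * |I n| ≤ |I n| :=
      mul_le_of_le_one_left (abs_nonneg _) (exp_le_one_iff.2 (by linarith))
    have h4 := hbd n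
    have h5 := hbd (n + 1)
    linarith
  have hI0 : I 0 = π / sinh α := by
    rw [eq_div_iff hS.ne', sinh_eq]
    rw [hone, cosh_eq] at hd0
    linarith
  have hstep (n : ℕ) : I (n + 1) = exp (-α) * I n := by
    have h := hd n
    rw [hd0, mul_zero] at h
    linarith
  change I n = _
  induction n with
  | zero => rw [hI0]; simp
  | succ n ih =>
    rw [hstep, ih, show -(((n + 1 : ℕ) : ℝ) * α) = -α + -(n * α) by push_cast; ring, exp_add]
    ring

lemma integral_one_sub_mul_cos_div (hα : 0 < α) (c : ℝ) (y : ℤ) :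
    ∫ φ in 0..π, (1 - c * cos (y * φ)) / (cosh α - cos φ)
      = π * ((1 - c * exp (-(|(y : ℝ)| * α))) / sinh α) := by
  have i (m : ℕ) : IntervalIntegrable (fun φ => cos (m * φ) / (cosh α - cos φ)) volume 0 π :=
    (continuous_cos_div_cosh_sub_cos hα m).intervalIntegrable _ _
  have hy : ((y.natAbs : ℕ) : ℝ) = |(y : ℝ)| := by
    rw [Nat.cast_natAbs, Int.cast_abs]
  have hcos (φ : ℝ) : cos (y * φ) = cos (y.natAbs * φ) := by
    rw [hy]
    rcases abs_choice (y : ℝ) with h | h <;> rw [h]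
    rw [neg_mul, cos_neg]
  have e : ∀ φ ∈ uIcc 0 π, (1 - c * cos (y * φ)) / (cosh α - cos φ)
      = cos ((0 : ℕ) * φ) / (cosh α - cos φ) - c * (cos (y.natAbs * φ) / (cosh α - cos φ)) := by
    intro φ _
    rw [hcos, Nat.cast_zero, zero_mul, cos_zero]
    ring
  rw [intervalIntegral.integral_congr e, intervalIntegral.integral_sub (i _) ((i _).const_mul _),
    intervalIntegral.integral_const_mul, integral_cos_div_cosh_sub_cos hα,
    integral_cos_div_cosh_sub_cos hα, hy]
  simp only [Nat.cast_zero, zero_mul, neg_zero, exp_zero]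
  ring

end Poisson

section Symmetry

variable {a b : ℝ}

lemma one_sub_cos_mul_cos_le (u v : ℝ) : 1 - cos u * cos v ≤ (u ^ 2 + v ^ 2) / 2 := by
  have h1 := one_sub_sq_div_two_le_cos (x := u)
  have h2 := one_sub_sq_div_two_le_cos (x := v)
  have h3 := cos_le_one v
  have h4 := cos_le_one u
  nlinarith [mul_nonneg (sub_nonneg.2 h4) (sub_nonneg.2 h3)]

lemma cos_mul_cos_le_one (u v : ℝ) : cos u * cos v ≤ 1 := by
  have := abs_le.1 (abs_cos_le_one u)
  have := abs_le.1 (abs_cos_le_one v)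
  nlinarith

lemma sq_le_one_sub_cos {θ : ℝ} (h0 : 0 < θ) (h1 : θ ≤ π) :
    2 / π ^ 2 * θ ^ 2 ≤ 1 - cos θ := by
  have h := cos_le_one_sub_mul_cos_sq (x := θ) (by rwa [abs_of_pos h0])
  linarith

/-- The integrand of the two-dimensional Fourier representation of the Green's function. -/
noncomputable def kernel (a b x y θ φ : ℝ) : ℝ :=
  (1 - cos (x * θ) * cos (y * φ)) / ((1 - cos θ) / a + (1 - cos φ) / b)

lemma kernel_swap (a b x y θ φ : ℝ) : kernel a b x y θ φ = kernel b a y x φ θ := by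
  unfold kernel
  rw [mul_comm (cos (x * θ)), add_comm ((1 - cos θ) / a)]

lemma abs_kernel_le (ha : 0 < a) (hb : 0 < b) (x y : ℝ) {θ φ : ℝ} (hθ : θ ∈ Ioc 0 π)
    (hφ : φ ∈ Ioc 0 π) : |kernel a b x y θ φ| ≤ π ^ 2 / 4 * (a * x ^ 2 + b * y ^ 2) := by
  have h1 := sq_le_one_sub_cos hθ.1 hθ.2
  have h2 := sq_le_one_sub_cos hφ.1 hφ.2
  have h3 := one_sub_cos_mul_cos_le (x * θ) (y * φ)
  have h4 := cos_mul_cos_le_one (x * θ) (y * φ)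
  have hθ0 := hθ.1
  have hφ0 := hφ.1
  have hlow : 2 / π ^ 2 * (θ ^ 2 / a + φ ^ 2 / b) ≤ (1 - cos θ) / a + (1 - cos φ) / b := by
    rw [mul_add, ← mul_div_assoc, ← mul_div_assoc]
    gcongr
  have hpos : 0 < (1 - cos θ) / a + (1 - cos φ) / b := lt_of_lt_of_le (by positivity) hlow
  rw [kernel, abs_div, abs_of_pos hpos, abs_of_nonneg (by linarith), div_le_iff₀ hpos]
  calc _ ≤ ((x * θ) ^ 2 + (y * φ) ^ 2) / 2 := h3
    _ ≤ ((x * θ) ^ 2 + (y * φ) ^ 2) / 2 + (a / b * (x * φ) ^ 2 + b / a * (y * θ) ^ 2) / 2 :=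
      le_add_of_nonneg_right (by positivity)
    _ = π ^ 2 / 4 * (a * x ^ 2 + b * y ^ 2) * (2 / π ^ 2 * (θ ^ 2 / a + φ ^ 2 / b)) := by
      field_simp
      ring
    _ ≤ _ := by gcongr

lemma integrableOn_kernel (ha : 0 < a) (hb : 0 < b) (x y : ℝ) :
    IntegrableOn (Function.uncurry (kernel a b x y)) (uIoc 0 π ×ˢ uIoc 0 π) := by
  have hm : Measurable (Function.uncurry (kernel a b x y)) := by
    unfold Function.uncurry kernel
    fun_prop
  rw [uIoc_of_le pi_pos.le]
  refine Measure.integrableOn_of_bounded (M := π ^ 2 / 4 * (a * x ^ 2 + b * y ^ 2)) ?_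
    hm.aestronglyMeasurable ?_
  · rw [Measure.volume_eq_prod, Measure.prod_prod]
    exact ENNReal.mul_ne_top measure_Ioc_lt_top.ne measure_Ioc_lt_top.ne
  · exact (ae_restrict_iff' (measurableSet_Ioc.prod measurableSet_Ioc)).2
      (Eventually.of_forall fun p hp => abs_kernel_le ha hb x y hp.1 hp.2)

lemma integral_kernel (ha : 0 < a) (hb : 0 < b) (x : ℝ) (y : ℤ) :
    ∫ θ in 0..π, ∫ φ in 0..π, kernel a b x y θ φ = b * π * green √(b / a) x |(y : ℝ)| := by
  have hk : 0 < √(b / a) := sqrt_pos.2 (div_pos hb ha)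
  have hk2 : √(b / a) ^ 2 = b / a := sq_sqrt (by positivity)
  rw [green, ← intervalIntegral.integral_const_mul]
  refine integral_congr_Ioc pi_pos.le fun θ hθ => ?_
  have hr := rate_pos hk hθ.1 hθ.2
  rw [mul_assoc, ← integral_one_sub_mul_cos_div hr, ← intervalIntegral.integral_const_mul]
  refine intervalIntegral.integral_congr fun φ _ => ?_
  have hp := (cosh_sub_cos_pos hr φ).ne'
  have e : (1 - cos θ) / a + (1 - cos φ) / b = (cosh (rate √(b / a) θ) - cos φ) / b := by
    rw [cosh_rate, hk2]
    field_simp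
    ring
  simp only [kernel, e]
  field_simp

/-- The Green's function may be computed by integrating out either Fourier variable. -/
lemma green_swap (ha : 0 < a) (hb : 0 < b) (x y : ℤ) :
    b * green √(b / a) x |(y : ℝ)| = a * green √(a / b) y |(x : ℝ)| := by
  have h := intervalIntegral_intervalIntegral_swap (integrableOn_kernel ha hb x y)
  rw [integral_kernel ha hb] at h
  simp only [kernel_swap a b] at h
  rw [integral_kernel hb ha] at h
  have := pi_ne_zero
  field_simp at h
  exact h

end Symmetry

section Recurrence

variable {k : ℝ}

lemma exp_neg_add_one_mul (y r : ℝ) : exp (-((y + 1) * r)) = exp (-(y * r)) * exp (-r) := by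
  rw [← exp_add]
  congr 1
  ring

lemma exp_neg_sub_one_mul (y r : ℝ) : exp (-((y - 1) * r)) = exp (-(y * r)) * exp r := by
  rw [← exp_add]
  congr 1
  ring

lemma integral_sub_two_mul_add {f g h : ℝ → ℝ} {a b : ℝ} (hf : IntervalIntegrable f volume a b)
    (hg : IntervalIntegrable g volume a b) (hh : IntervalIntegrable h volume a b) :
    (∫ t in a..b, f t) - 2 * (∫ t in a..b, g t) + ∫ t in a..b, h t
      = ∫ t in a..b, (f t - 2 * g t + h t) := by
  rw [intervalIntegral.integral_add (hf.sub (hg.const_mul 2)) hh,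
    intervalIntegral.integral_sub hf (hg.const_mul 2), intervalIntegral.integral_const_mul]

lemma green_recurrence (hk : 0 < k) (x : ℝ) {y : ℝ} (hy : 1 ≤ y) :
    k ^ 2 * (green k (x + 1) y - 2 * green k x y + green k (x - 1) y)
      + (green k x (y + 1) - 2 * green k x y + green k x (y - 1)) = 0 := by
  have i (x : ℝ) {y : ℝ} (hy : 0 ≤ y) := intervalIntegrable_green hk x hy
  have y0 : 0 ≤ y := by linarith
  have y1 : 0 ≤ y + 1 := by linarith
  have y2 : 0 ≤ y - 1 := by linarith
  simp only [green]
  rw [integral_sub_two_mul_add (i _ y0) (i _ y0) (i _ y0),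
    integral_sub_two_mul_add (i _ y1) (i _ y0) (i _ y2), add_eq_zero_iff_neg_eq, ← neg_mul,
    ← intervalIntegral.integral_const_mul]
  refine integral_congr_Ioc pi_pos.le fun θ hθ => ?_
  have hS := (sinh_rate_pos hk hθ.1 hθ.2).ne'
  have hc := cosh_rate k θ
  rw [cosh_eq] at hc
  rw [exp_neg_add_one_mul, exp_neg_sub_one_mul]
  simp only [add_mul, sub_mul, one_mul, cos_add, cos_sub]
  field_simp
  linear_combination (2 * cos (x * θ) * exp (-(y * rate k θ))) * hc

lemma green_recurrence_zero (hk : 0 < k) (x : ℝ) :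
    k ^ 2 * (green k (x + 1) 0 - 2 * green k x 0 + green k (x - 1) 0)
      + (green k x 1 - 2 * green k x 0 + green k x 1) = 2 * ∫ θ in 0..π, cos (x * θ) := by
  have i (x : ℝ) {y : ℝ} (hy : 0 ≤ y) := intervalIntegrable_green hk x hy
  have y0 : (0 : ℝ) ≤ 0 := le_rfl
  have y1 : (0 : ℝ) ≤ 1 := zero_le_one
  simp only [green]
  rw [integral_sub_two_mul_add (i _ y0) (i _ y0) (i _ y0),
    integral_sub_two_mul_add (i _ y1) (i _ y0) (i _ y1),
    ← intervalIntegral.integral_const_mul, ← intervalIntegral.integral_const_mul,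
    ← intervalIntegral.integral_add
      (((((i _ y0).sub ((i _ y0).const_mul 2)).add (i _ y0))).const_mul _)
      (((i _ y1).sub ((i _ y0).const_mul 2)).add (i _ y1))]
  refine integral_congr_Ioc pi_pos.le fun θ hθ => ?_
  have hS := (sinh_rate_pos hk hθ.1 hθ.2).ne'
  have hc := cosh_rate k θ
  have hs := sinh_eq (rate k θ)
  rw [cosh_eq] at hc
  simp only [add_mul, sub_mul, one_mul, cos_add, cos_sub, zero_mul, neg_zero, exp_zero]
  field_simp
  linear_combination (-2 * cos (x * θ)) * hc - 2 * cos (x * θ) * hs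

lemma green_add_one_sub (hk : 0 < k) (x : ℝ) {y : ℝ} (hy : 0 ≤ y) :
    green k (x + 1) y - green k (x - 1) y
      = 2 * ∫ θ in 0..π, sin (x * θ) * (sin θ / sinh (rate k θ)) * exp (-(y * rate k θ)) := by
  rw [green, green, ← intervalIntegral.integral_sub (intervalIntegrable_green hk _ hy)
    (intervalIntegrable_green hk _ hy), ← intervalIntegral.integral_const_mul]
  refine intervalIntegral.integral_congr fun θ _ => ?_
  simp only [add_mul, sub_mul, one_mul, cos_add, cos_sub]
  ring

lemma green_add_one_sub_right (hk : 0 < k) (x : ℝ) {y : ℝ} (hy : 1 ≤ y) :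
    green k x (y + 1) - green k x (y - 1)
      = 2 * ∫ θ in 0..π, cos (x * θ) * exp (-(y * rate k θ)) := by
  rw [green, green, ← intervalIntegral.integral_sub (intervalIntegrable_green hk _ (by linarith))
    (intervalIntegrable_green hk _ (by linarith)), ← intervalIntegral.integral_const_mul]
  refine integral_congr_Ioc pi_pos.le fun θ hθ => ?_
  have hS := sinh_rate_pos hk hθ.1 hθ.2
  rw [← sub_div, div_eq_iff hS.ne', exp_neg_add_one_mul, exp_neg_sub_one_mul, sinh_eq]
  ring

end Recurrence

section Value

variable {k : ℝ}

lemma integral_sin_half_div_sqrt (hk : 0 < k) :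
    ∫ θ in 0..π, sin (θ / 2) / √(1 + (k * sin (θ / 2)) ^ 2) = 2 / k * arctan k := by
  have hd : ∀ θ ∈ uIcc 0 π, HasDerivAt
      (fun θ => -(2 / k) * arctan (k * cos (θ / 2) / √(1 + (k * sin (θ / 2)) ^ 2)))
      (sin (θ / 2) / √(1 + (k * sin (θ / 2)) ^ 2)) θ := by
    intro θ _
    have hq : 0 < √(1 + (k * sin (θ / 2)) ^ 2) := by positivity
    refine (((((hasDerivAt_cos_half θ).const_mul k).fun_div (hasDerivAt_sqrt_sin_half k θ)
      hq.ne').arctan).const_mul (-(2 / k))).congr_deriv ?_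
    have hq2 : √(1 + (k * sin (θ / 2)) ^ 2) ^ 2 = 1 + (k * sin (θ / 2)) ^ 2 :=
      sq_sqrt (by positivity)
    have hsc : cos (θ / 2) ^ 2 = 1 - sin (θ / 2) ^ 2 := cos_sq' (θ / 2)
    set s := sin (θ / 2)
    set c := cos (θ / 2)
    set q := √(1 + (k * s) ^ 2)
    have hk2 : (1 + k ^ 2) ≠ 0 := by positivity
    have e1 : 1 + (k * c / q) ^ 2 = (1 + k ^ 2) / q ^ 2 := by
      rw [div_pow, eq_div_iff (by positivity), add_mul, div_mul_cancel₀ _ (by positivity)]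
      linear_combination hq2 + k ^ 2 * hsc
    rw [e1]
    field_simp
    linear_combination s * hq2 + (k ^ 2 * s) * hsc
  have hc : Continuous fun θ => sin (θ / 2) / √(1 + (k * sin (θ / 2)) ^ 2) :=
    Continuous.div (by fun_prop) (by fun_prop) fun θ => by positivity
  rw [intervalIntegral.integral_eq_sub_of_hasDerivAt hd (hc.intervalIntegrable _ _)]
  simp

lemma green_one_zero (hk : 0 < k) : green k 1 0 = 2 / k ^ 2 * arctan k := by
  have e : 2 / k ^ 2 * arctan k = 1 / k * (2 / k * arctan k) := by ring
  rw [e, ← integral_sin_half_div_sqrt hk, green, ← intervalIntegral.integral_const_mul]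
  refine integral_congr_Ioc pi_pos.le fun θ hθ => ?_
  have hs := sin_half_pos hθ.1 hθ.2
  have hc := cosh_rate k θ
  have h : cos θ = 1 - 2 * sin (θ / 2) ^ 2 := by
    have h1 := cos_two_mul (θ / 2)
    have h2 := sin_sq_add_cos_sq (θ / 2)
    rw [mul_div_cancel₀ θ two_ne_zero] at h1
    linarith
  rw [sinh_rate, one_mul, zero_mul, neg_zero, exp_zero, mul_one, h]
  field_simp
  ring

lemma green_zero_zero (k : ℝ) : green k 0 0 = 0 := by
  simp [green]

end Value

section Lattice

variable {a b : ℝ}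

/-- The lattice-regularized logarithm with weights `a` and `b`. -/
noncomputable def latticeLog (a b : ℝ) (x y : ℤ) : ℝ :=
  b / (2 * π) * green √(b / a) x |(y : ℝ)|

lemma latticeLog_zero (a b : ℝ) : latticeLog a b 0 0 = 0 := by
  simp [latticeLog, green_zero_zero]

lemma latticeLog_neg_left (a b : ℝ) (x y : ℤ) : latticeLog a b (-x) y = latticeLog a b x y := by
  simp only [latticeLog, green, Int.cast_neg, neg_mul, cos_neg]

lemma latticeLog_neg_right (a b : ℝ) (x y : ℤ) : latticeLog a b x (-y) = latticeLog a b x y := by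
  simp only [latticeLog, Int.cast_neg, abs_neg]

lemma latticeLog_swap (ha : 0 < a) (hb : 0 < b) (x y : ℤ) :
    latticeLog a b x y = latticeLog b a y x := by
  rw [latticeLog, latticeLog, div_mul_eq_mul_div, green_swap ha hb, div_mul_eq_mul_div]

lemma latticeLog_eq_of_nonneg (a b : ℝ) (x : ℤ) {y : ℤ} (hy : 0 ≤ y) :
    latticeLog a b x y = b / (2 * π) * green √(b / a) x y := by
  rw [latticeLog, abs_of_nonneg (Int.cast_nonneg hy)]

lemma integral_cos_int_mul (x : ℤ) : ∫ θ in 0..π, cos (x * θ) = if x = 0 then π else 0 := by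
  split_ifs with h
  · simp [h]
  · rw [intervalIntegral.integral_comp_mul_left (fun u => cos u) (Int.cast_ne_zero.2 h),
      integral_cos, sin_int_mul_pi]
    simp

lemma latticeLog_laplacian_of_pos (ha : 0 < a) (hb : 0 < b) (x : ℤ) {y : ℤ} (hy : 0 < y) :
    (1 / a) * (latticeLog a b (x + 1) y - 2 * latticeLog a b x y + latticeLog a b (x - 1) y)
      + (1 / b) * (latticeLog a b x (y + 1) - 2 * latticeLog a b x y + latticeLog a b x (y - 1))
      = 0 := by
  have hk2 : √(b / a) ^ 2 = b / a := sq_sqrt (by positivity)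
  have h := green_recurrence (sqrt_pos.2 (div_pos hb ha)) x (y := y) (by exact_mod_cast hy)
  have y1 : 0 ≤ y + 1 := by lia
  have y2 : 0 ≤ y - 1 := by lia
  rw [hk2] at h
  simp only [latticeLog_eq_of_nonneg a b _ hy.le, latticeLog_eq_of_nonneg a b _ y1,
    latticeLog_eq_of_nonneg a b _ y2]
  push_cast
  have := pi_ne_zero
  field_simp at h ⊢
  linear_combination h

lemma latticeLog_laplacian (ha : 0 < a) (hb : 0 < b) (x y : ℤ) :
    (1 / a) * (latticeLog a b (x + 1) y - 2 * latticeLog a b x y + latticeLog a b (x - 1) y)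
      + (1 / b) * (latticeLog a b x (y + 1) - 2 * latticeLog a b x y + latticeLog a b x (y - 1))
      = if (x, y) = (0, 0) then 1 else 0 := by
  rcases lt_trichotomy y 0 with hy | rfl | hy
  · rw [if_neg (by simp [hy.ne])]
    have h := latticeLog_laplacian_of_pos ha hb x (neg_pos.2 hy)
    rw [show -y + 1 = -(y - 1) by ring, show -y - 1 = -(y + 1) by ring] at h
    simp only [latticeLog_neg_right] at h
    linarith
  · have hk2 : √(b / a) ^ 2 = b / a := sq_sqrt (by positivity)
    have h := green_recurrence_zero (sqrt_pos.2 (div_pos hb ha)) x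
    rw [hk2, integral_cos_int_mul] at h
    have e : (if (x, (0 : ℤ)) = (0, 0) then (1 : ℝ) else 0) = (if x = 0 then π else 0) / π := by
      by_cases hx : x = 0 <;> simp [hx, pi_ne_zero]
    rw [e]
    simp only [latticeLog]
    push_cast
    simp only [abs_neg, abs_one, abs_zero]
    generalize (if x = 0 then π else 0) = z at h ⊢
    have := pi_ne_zero
    field_simp at h ⊢
    linear_combination h
  · rw [if_neg (by simp [hy.ne'])]
    exact latticeLog_laplacian_of_pos ha hb x hy

lemma latticeLog_one_zero (ha : 0 < a) (hb : 0 < b) :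
    latticeLog a b 1 0 = a / π * arctan √(b / a) := by
  have hk2 : √(b / a) ^ 2 = b / a := sq_sqrt (by positivity)
  rw [latticeLog, Int.cast_one, Int.cast_zero, abs_zero,
    green_one_zero (sqrt_pos.2 (div_pos hb ha)), hk2]
  field_simp

lemma latticeLog_zero_one (ha : 0 < a) (hb : 0 < b) :
    latticeLog a b 0 1 = b / π * arctan √(a / b) := by
  rw [latticeLog_swap ha hb, latticeLog_one_zero hb ha]

end Lattice

section LatticeAsymptotics

variable {a b : ℝ}

lemma div_sqrt_div_eq (ha : 0 < a) (hb : 0 < b) : b / √(b / a) = √(a * b) := by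
  rw [sqrt_div hb.le, sqrt_mul ha.le, div_div_eq_mul_div, mul_comm, div_eq_iff (by positivity),
    mul_assoc, mul_self_sqrt hb.le]

/-- The logarithmic main term of `latticeLog`. -/
noncomputable def mainTerm (a b x y : ℝ) : ℝ :=
  √(a * b) / (4 * π) * log (16 * exp (2 * eulerMascheroniConstant) / (a + b) *
    (a * x ^ 2 + b * y ^ 2))

lemma mainTerm_swap (a b x y : ℝ) : mainTerm a b x y = mainTerm b a y x := by
  rw [mainTerm, mainTerm, mul_comm a b, add_comm a b, add_comm (a * x ^ 2)]

lemma mainTerm_eq (ha : 0 < a) (hb : 0 < b) (x : ℝ) {y : ℝ} (hy : 0 < y) :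
    mainTerm a b x y = b / (2 * π) * ((log 4 - log (1 + √(b / a) ^ 2) / 2
      + eulerMascheroniConstant + log (x ^ 2 + (√(b / a) * y) ^ 2) / 2) / √(b / a)) := by
  have hk2 : √(b / a) ^ 2 = b / a := sq_sqrt (by positivity)
  have e1 : 16 * exp (2 * eulerMascheroniConstant) / (a + b) * (a * x ^ 2 + b * y ^ 2)
      = 4 ^ 2 * exp (2 * eulerMascheroniConstant) * ((x ^ 2 + (√(b / a) * y) ^ 2)
        / (1 + √(b / a) ^ 2)) := by
    rw [mul_pow, hk2]
    field_simp
    ring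
  have h1 : x ^ 2 + (√(b / a) * y) ^ 2 ≠ 0 := by positivity
  have h2 : 1 + √(b / a) ^ 2 ≠ 0 := by positivity
  rw [mainTerm, e1, log_mul (by positivity) (by positivity), log_mul (by norm_num)
    (exp_ne_zero _), log_exp, log_pow, log_div h1 h2, ← div_sqrt_div_eq ha hb]
  push_cast
  ring

lemma exists_latticeLog_sub_mainTerm_le_of_le (ha : 0 < a) (hb : 0 < b) :
    ∃ C : ℝ, 0 ≤ C ∧ ∀ x y : ℤ, y ≠ 0 → |x| ≤ |y| →
      |latticeLog a b x y - mainTerm a b x y| ≤ C / ((x : ℝ) ^ 2 + (y : ℝ) ^ 2) := by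
  obtain ⟨C, hC, h⟩ := green_asymptotics (sqrt_pos.2 (div_pos hb ha))
  refine ⟨b / (2 * π) * (2 * C), by positivity, fun x y hy hxy => ?_⟩
  have hy1 : (1 : ℝ) ≤ |(y : ℝ)| := by exact_mod_cast Int.one_le_abs hy
  have hxy' : |(x : ℝ)| ≤ |(y : ℝ)| := by exact_mod_cast hxy
  have hy0 : 0 < |(y : ℝ)| := by linarith
  have hm : mainTerm a b x y = mainTerm a b x |(y : ℝ)| := by rw [mainTerm, mainTerm, sq_abs]
  have hsq : (x : ℝ) ^ 2 ≤ (y : ℝ) ^ 2 := sq_le_sq.2 hxy'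
  have hy2 : 0 < (y : ℝ) ^ 2 := by rw [← sq_abs]; positivity
  rw [latticeLog, hm, mainTerm_eq ha hb x hy0, ← mul_sub, abs_mul,
    abs_of_pos (by positivity : 0 < b / (2 * π)), mul_div_assoc]
  refine mul_le_mul_of_nonneg_left ((h _ _ hy1 hxy').trans ?_) (by positivity)
  rw [sq_abs, div_le_div_iff₀ hy2 (by positivity)]
  nlinarith

lemma exists_latticeLog_sub_mainTerm_le (ha : 0 < a) (hb : 0 < b) :
    ∃ C : ℝ, 0 ≤ C ∧ ∀ x y : ℤ, (x, y) ≠ (0, 0) →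
      |latticeLog a b x y - mainTerm a b x y| ≤ C / ((x : ℝ) ^ 2 + (y : ℝ) ^ 2) := by
  obtain ⟨C, hC, h⟩ := exists_latticeLog_sub_mainTerm_le_of_le ha hb
  obtain ⟨D, hD, h'⟩ := exists_latticeLog_sub_mainTerm_le_of_le hb ha
  refine ⟨C + D, by positivity, fun x y hxy => ?_⟩
  rw [Ne, Prod.mk.injEq] at hxy
  rcases le_total |x| |y| with hle | hle
  · have hy : y ≠ 0 := by
      rintro rfl
      exact hxy ⟨by simpa using hle, rfl⟩
    refine (h x y hy hle).trans ?_
    gcongr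
    linarith
  · have hx : x ≠ 0 := by
      rintro rfl
      exact hxy ⟨rfl, by simpa using hle⟩
    rw [latticeLog_swap ha hb, mainTerm_swap]
    refine (h' y x hx hle).trans ?_
    rw [add_comm ((y : ℝ) ^ 2)]
    gcongr
    linarith

/-- The main term of the centered first difference of `latticeLog` in the first variable. -/
noncomputable def diffTerm (a b x y : ℝ) : ℝ :=
  √(a * b) / (2 * π) * (a * x) / (a * x ^ 2 + b * y ^ 2)

lemma div_pow_three_le {C x y : ℝ} (hC : 0 ≤ C) (hy : 0 < y) (h : |x| ≤ y) :
    C / y ^ 3 ≤ 2 ^ ((3 : ℝ) / 2) * C / (x ^ 2 + y ^ 2) ^ ((3 : ℝ) / 2) := by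
  have hsq : x ^ 2 ≤ y ^ 2 := sq_le_sq.2 (h.trans (le_abs_self y))
  have e : (x ^ 2 + y ^ 2) ^ ((3 : ℝ) / 2) ≤ 2 ^ ((3 : ℝ) / 2) * y ^ 3 := by
    calc (x ^ 2 + y ^ 2) ^ ((3 : ℝ) / 2) ≤ (2 * y ^ 2) ^ ((3 : ℝ) / 2) := by
          gcongr
          linarith
      _ = 2 ^ ((3 : ℝ) / 2) * y ^ 3 := by
          rw [mul_rpow two_pos.le (sq_nonneg y), ← rpow_natCast_mul hy.le, ← rpow_natCast]
          norm_num
  rw [div_le_div_iff₀ (by positivity) (by positivity)]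
  calc C * (x ^ 2 + y ^ 2) ^ ((3 : ℝ) / 2) ≤ C * (2 ^ ((3 : ℝ) / 2) * y ^ 3) := by gcongr
    _ = _ := by ring

lemma exists_latticeLog_left_diff_le_of_pos (ha : 0 < a) (hb : 0 < b) :
    ∃ C : ℝ, 0 ≤ C ∧ ∀ x y : ℤ, 0 < y → |x| ≤ y →
      |(latticeLog a b (x + 1) y - latticeLog a b (x - 1) y) / 2 - diffTerm a b x y|
        ≤ C / ((x : ℝ) ^ 2 + (y : ℝ) ^ 2) ^ ((3 : ℝ) / 2) := by
  have hk : 0 < √(b / a) := sqrt_pos.2 (div_pos hb ha)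
  have hk2 : √(b / a) ^ 2 = b / a := sq_sqrt (by positivity)
  obtain ⟨C, hC, h⟩ := integral_sin_mul_exp_rate_asymptotics hk
  refine ⟨2 ^ ((3 : ℝ) / 2) * (b / (2 * π) * C), by positivity, fun x y hy hxy => ?_⟩
  have hy0 : (0 : ℝ) < y := by exact_mod_cast hy
  have hxy' : |(x : ℝ)| ≤ y := by exact_mod_cast hxy
  refine le_trans ?_ (div_pow_three_le (by positivity) hy0 hxy')
  have hdiff := green_add_one_sub hk x hy0.le
  have e : (latticeLog a b (x + 1) y - latticeLog a b (x - 1) y) / 2 - diffTerm a b x y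
      = b / (2 * π) * ((∫ θ in 0..π, sin (x * θ) * (sin θ / sinh (rate √(b / a) θ))
        * exp (-(y * rate √(b / a) θ))) - x / (x ^ 2 + (√(b / a) * y) ^ 2) / √(b / a)) := by
    rw [latticeLog_eq_of_nonneg a b _ hy.le, latticeLog_eq_of_nonneg a b _ hy.le, diffTerm,
      ← div_sqrt_div_eq ha hb, mul_pow, hk2, ← mul_sub]
    push_cast
    rw [hdiff]
    have : a * (x : ℝ) ^ 2 + b * y ^ 2 ≠ 0 := by positivity
    field_simp
  rw [e, abs_mul, abs_of_pos (by positivity : 0 < b / (2 * π)),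
    mul_div_assoc (b / (2 * π))]
  exact mul_le_mul_of_nonneg_left (h _ _ hy0) (by positivity)

lemma exists_latticeLog_right_diff_le_of_pos (ha : 0 < a) (hb : 0 < b) :
    ∃ C : ℝ, 0 ≤ C ∧ ∀ x y : ℤ, 0 < y → |x| ≤ y →
      |(latticeLog a b x (y + 1) - latticeLog a b x (y - 1)) / 2 - diffTerm b a y x|
        ≤ C / ((x : ℝ) ^ 2 + (y : ℝ) ^ 2) ^ ((3 : ℝ) / 2) := by
  have hk : 0 < √(b / a) := sqrt_pos.2 (div_pos hb ha)
  have hk2 : √(b / a) ^ 2 = b / a := sq_sqrt (by positivity)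
  obtain ⟨C, hC, h⟩ := integral_cos_mul_exp_rate_asymptotics hk
  refine ⟨2 ^ ((3 : ℝ) / 2) * (b / (2 * π) * C), by positivity, fun x y hy hxy => ?_⟩
  have hy0 : (0 : ℝ) < y := by exact_mod_cast hy
  have hxy' : |(x : ℝ)| ≤ y := by exact_mod_cast hxy
  refine le_trans ?_ (div_pow_three_le (by positivity) hy0 hxy')
  have hdiff := green_add_one_sub_right hk x (y := y) (by exact_mod_cast hy)
  have e : (latticeLog a b x (y + 1) - latticeLog a b x (y - 1)) / 2 - diffTerm b a y x
      = b / (2 * π) * ((∫ θ in 0..π, cos (x * θ) * exp (-(y * rate √(b / a) θ)))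
        - √(b / a) * y / (x ^ 2 + (√(b / a) * y) ^ 2)) := by
    rw [latticeLog_eq_of_nonneg a b _ (by lia), latticeLog_eq_of_nonneg a b _ (by lia), diffTerm,
      mul_comm b a, ← div_sqrt_div_eq ha hb, mul_pow, hk2, ← mul_sub]
    push_cast
    rw [hdiff]
    have h1 : b * (y : ℝ) ^ 2 + a * x ^ 2 ≠ 0 := by positivity
    have h2 : (x : ℝ) ^ 2 + b / a * y ^ 2 ≠ 0 := by positivity
    have h3 : b / √(b / a) = √(b / a) * a := by
      rw [div_eq_iff hk.ne', mul_right_comm, ← sq, hk2, div_mul_cancel₀ _ ha.ne']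
    rw [h3]
    field_simp
    ring
  rw [e, abs_mul, abs_of_pos (by positivity : 0 < b / (2 * π)),
    mul_div_assoc (b / (2 * π))]
  exact mul_le_mul_of_nonneg_left (h _ _ hy0) (by positivity)

lemma diffTerm_neg_left (a b x y : ℝ) : diffTerm a b (-x) y = -diffTerm a b x y := by
  rw [diffTerm, diffTerm, neg_sq]
  ring

lemma diffTerm_neg_right (a b x y : ℝ) : diffTerm a b x (-y) = diffTerm a b x y := by
  rw [diffTerm, diffTerm, neg_sq]

lemma exists_latticeLog_diff_le (ha : 0 < a) (hb : 0 < b) :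
    ∃ C : ℝ, 0 ≤ C ∧ ∀ x y : ℤ, (x, y) ≠ (0, 0) →
      |(latticeLog a b (x + 1) y - latticeLog a b (x - 1) y) / 2 - diffTerm a b x y|
        ≤ C / ((x : ℝ) ^ 2 + (y : ℝ) ^ 2) ^ ((3 : ℝ) / 2) := by
  obtain ⟨C, hC, h⟩ := exists_latticeLog_left_diff_le_of_pos ha hb
  obtain ⟨D, hD, h'⟩ := exists_latticeLog_right_diff_le_of_pos hb ha
  refine ⟨C + D, by positivity, fun x y hxy => ?_⟩
  wlog hx : 0 ≤ x generalizing x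
  · have hneg := this (-x) (by simpa using hxy) (by lia)
    rw [show -x + 1 = -(x - 1) by ring, show -x - 1 = -(x + 1) by ring, latticeLog_neg_left,
      latticeLog_neg_left, Int.cast_neg, diffTerm_neg_left, neg_sq, ← abs_neg] at hneg
    convert hneg using 2
    ring
  wlog hy : 0 ≤ y generalizing y
  · have hneg := this (-y) (by simpa using hxy) (by lia)
    rwa [latticeLog_neg_right, latticeLog_neg_right, Int.cast_neg, diffTerm_neg_right,
      neg_sq] at hneg
  rw [Ne, Prod.mk.injEq] at hxy
  rcases le_total x y with hle | hle
  · refine (h x y (by lia) (by rwa [abs_of_nonneg hx])).trans ?_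
    gcongr
    linarith
  · rw [latticeLog_swap ha hb, latticeLog_swap ha hb]
    refine (h' y x (by lia) (by rwa [abs_of_nonneg hy])).trans ?_
    rw [add_comm ((y : ℝ) ^ 2)]
    gcongr
    linarith

end LatticeAsymptotics

end LatticeLog

/-- Existence of the lattice-regularized logarithm (anisotropic discrete Green's function)
`L_{(a,b)}` on `ℤ²`: it vanishes at the origin, is even in each coordinate, satisfies
`(a⁻¹ D_x² + b⁻¹ D_y²) L = δ₀`, has the stated values at `(1,0)` and `(0,1)`, and has the
logarithmic asymptotic expansion with constant `16 e^{2γ}/(a+b)` together with the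
asymptotics of its centered first difference. -/
theorem exists_lattice_log (a b : ℝ) (ha : 0 < a) (hb : 0 < b) :
    ∃ (L : ℤ × ℤ → ℝ) (C : ℝ), 0 ≤ C ∧
      L (0, 0) = 0 ∧
      (∀ x y : ℤ, L (-x, y) = L (x, y) ∧ L (x, -y) = L (x, y)) ∧
      (∀ x y : ℤ,
        (1 / a) * (L (x + 1, y) - 2 * L (x, y) + L (x - 1, y))
          + (1 / b) * (L (x, y + 1) - 2 * L (x, y) + L (x, y - 1))
          = if (x, y) = (0, 0) then 1 else 0) ∧
      L (1, 0) = (a / Real.pi) * Real.arctan (Real.sqrt (b / a)) ∧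
      L (0, 1) = (b / Real.pi) * Real.arctan (Real.sqrt (a / b)) ∧
      (∀ x y : ℤ, (x, y) ≠ (0, 0) →
        |L (x, y) - (Real.sqrt (a * b) / (4 * Real.pi)) *
            Real.log ((16 * Real.exp (2 * Real.eulerMascheroniConstant) / (a + b)) *
              (a * (x : ℝ) ^ 2 + b * (y : ℝ) ^ 2))|
          ≤ C / ((x : ℝ) ^ 2 + (y : ℝ) ^ 2)) ∧
      (∀ x y : ℤ, (x, y) ≠ (0, 0) →
        |(L (x + 1, y) - L (x - 1, y)) / 2 - (Real.sqrt (a * b) / (2 * Real.pi)) *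
            (a * (x : ℝ)) / (a * (x : ℝ) ^ 2 + b * (y : ℝ) ^ 2)|
          ≤ C / ((x : ℝ) ^ 2 + (y : ℝ) ^ 2) ^ ((3 : ℝ) / 2)) := by
  obtain ⟨C, hC, h⟩ := LatticeLog.exists_latticeLog_sub_mainTerm_le ha hb
  obtain ⟨D, hD, h'⟩ := LatticeLog.exists_latticeLog_diff_le ha hb
  refine ⟨fun p => LatticeLog.latticeLog a b p.1 p.2, C + D, by positivity,
    LatticeLog.latticeLog_zero a b,
    fun x y => ⟨LatticeLog.latticeLog_neg_left a b x y, LatticeLog.latticeLog_neg_right a b x y⟩,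
    LatticeLog.latticeLog_laplacian ha hb, LatticeLog.latticeLog_one_zero ha hb,
    LatticeLog.latticeLog_zero_one ha hb, fun x y hxy => (h x y hxy).trans ?_,
    fun x y hxy => (h' x y hxy).trans ?_⟩
  · gcongr
    linarith
  · gcongr
    linarith
end
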